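/- arXiv:2512.14159 — 10 statements merged into one kernel-verified Lean document; each statement's English description precedes it below -/
import Mathlib

section
/- Let N ≥ 1, let I ⊆ ℝ be an open interval, let m : I → Matrix (Fin N) (Fin N) ℂ be differentiable, and let φ, ψ : I → (Fin N → ℂ) be functions such that (d/dt) m_{jk}(t) = φ_j(t)·ψ_k(t) for all j,k and all t ∈ I. Then for every t ∈ I, the derivative (d/dt) det(m(t)) equals the determinant of the (N+1)×(N+1) bordered matrix whose top-left N×N block is m(t), whose last column is (φ_1(t),…,φ_N(t),0)ᵀ, and whose last row is (−ψ_1(t),…,−ψ_N(t),0). -/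
namespace Matrix

variable {n R : Type*} [Fintype n] [DecidableEq n] [CommRing R]

/-- The determinant of a matrix bordered by a column `u`, a row `-v` and a zero corner measures the
change of the determinant under the rank-one update `u vᵀ`. -/
theorem det_fromBlocks_replicateCol_neg_replicateRow_zero (A : Matrix n n R) (u v : n → R) :
    (fromBlocks A (replicateCol (Fin 1) u) (-replicateRow (Fin 1) v) 0).det =
      (A + vecMulVec u v).det - A.det := by
  have hsplit :
      (fromBlocks A (replicateCol (Fin 1) u) (-replicateRow (Fin 1) v) 1).det =
        (fromBlocks A (replicateCol (Fin 1) u) (-replicateRow (Fin 1) v) 0).det +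
          (fromBlocks A (replicateCol (Fin 1) u) 0 1).det := by
    have hadd := det_updateRow_add
      (fromBlocks A (replicateCol (Fin 1) u) (-replicateRow (Fin 1) v) 0) (Sum.inr 0)
      (Sum.elim (-v) 0) (Sum.elim 0 1)
    convert! hadd using 2
    · ext (i | i) (j | j) <;> simp [updateRow_apply, one_apply, eq_iff_true_of_subsingleton]
    · congr 1
      ext (i | i) (j | j) <;> simp [updateRow_apply, eq_iff_true_of_subsingleton]
    · congr 1
      ext (i | i) (j | j) <;> simp [updateRow_apply, one_apply, eq_iff_true_of_subsingleton]
  have houter : replicateCol (Fin 1) u * replicateRow (Fin 1) v = vecMulVec u v := by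
    ext
    simp [mul_apply, vecMulVec_apply]
  rw [det_fromBlocks_one₂₂, det_fromBlocks_zero₂₁, det_one, mul_one, Matrix.mul_neg,
    sub_neg_eq_add, houter] at hsplit
  exact eq_sub_of_add_eq hsplit.symm

/-- Along a rank-one direction the determinant is affine, with slope a bordered determinant. -/
theorem det_add_smul_vecMulVec (A : Matrix n n R) (u v : n → R) (s : R) :
    (A + s • vecMulVec u v).det =
      A.det +
        s * (fromBlocks A (replicateCol (Fin 1) u) (-replicateRow (Fin 1) v) 0).det := by
  have hscale : fromBlocks A (replicateCol (Fin 1) (s • u)) (-replicateRow (Fin 1) v) 0 =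
      fromBlocks A (replicateCol (Fin 1) u) (-replicateRow (Fin 1) v) 0 *
        fromBlocks 1 0 0 (s • (1 : Matrix (Fin 1) (Fin 1) R)) := by
    simp [fromBlocks_multiply, replicateCol_smul]
  have hdet := det_fromBlocks_replicateCol_neg_replicateRow_zero A (s • u) v
  rw [hscale, det_mul, det_fromBlocks_zero₂₁, smul_vecMulVec] at hdet
  simp only [det_one, det_smul, Fintype.card_fin, pow_one, mul_one, one_mul] at hdet
  linear_combination -hdet

/-- The determinant is differentiable as a function of the matrix entries. -/
theorem differentiable_det_of :
    Differentiable ℝ (fun A : n → n → ℂ => (of A).det) := by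
  simp only [det_apply, of_apply]
  fun_prop

/-- If the entrywise derivative of a matrix-valued function is `u vᵀ`, then the derivative of its
determinant is a bordered determinant. -/
theorem hasDerivAt_det_of_vecMulVec {m : ℝ → Matrix n n ℂ} {u v : n → ℂ} {t : ℝ}
    (hm : ∀ j k, HasDerivAt (fun s => m s j k) (u j * v k) t) :
    HasDerivAt (fun s => (m s).det)
      (fromBlocks (m t) (replicateCol (Fin 1) u) (-replicateRow (Fin 1) v) 0).det t := by
  have hdet := (differentiable_det_of (n := n) (m t)).hasFDerivAt
  have hcurve : HasDerivAt (fun s j k => m s j k) (fun j k => u j * v k) t :=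
    hasDerivAt_pi.2 fun j => hasDerivAt_pi.2 fun k => hm j k
  have hline : HasDerivAt (fun (s : ℝ) j k => m t j k + s * (u j * v k))
      (fun j k => u j * v k) 0 :=
    hasDerivAt_pi.2 fun j => hasDerivAt_pi.2 fun k => by
      simpa using ((Complex.ofRealCLM.hasDerivAt (x := 0)).mul_const (u j * v k)).const_add (m t j k)
  have hdet_line := HasFDerivAt.comp_hasDerivAt_of_eq (0 : ℝ) hdet hline (by ext; simp)
  have haffine : HasDerivAt (fun s : ℝ => (m t).det +
      s * (fromBlocks (m t) (replicateCol (Fin 1) u) (-replicateRow (Fin 1) v) 0).det)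
      (fromBlocks (m t) (replicateCol (Fin 1) u) (-replicateRow (Fin 1) v) 0).det 0 := by
    simpa using ((Complex.ofRealCLM.hasDerivAt (x := 0)).mul_const _).const_add (m t).det
  have hslope := hdet_line.unique (haffine.congr_of_eventuallyEq (.of_forall fun s =>
    det_add_smul_vecMulVec (m t) u v s))
  exact hslope ▸ hdet.comp_hasDerivAt t hcurve

end Matrix


/-- if the `t`-derivative of each entry of an `N × N` matrix-valued function is the
rank-one product `φ_j(t) ψ_k(t)`, then the derivative of its determinant is the bordered
`(N+1) × (N+1)` determinant with last column `(φ, 0)ᵀ` and last row `(−ψ, 0)`. -/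
theorem deriv_det_bordered (N : ℕ) (hN : 1 ≤ N) (a b : ℝ)
    (m : ℝ → Matrix (Fin N) (Fin N) ℂ) (φ ψ : ℝ → Fin N → ℂ)
    (hderiv : ∀ t ∈ Set.Ioo a b, ∀ j k : Fin N,
      HasDerivAt (fun s => m s j k) (φ t j * ψ t k) t) :
    ∀ t ∈ Set.Ioo a b,
      HasDerivAt (fun s => (m s).det)
        (Matrix.det (Matrix.of (fun i j : Fin (N + 1) =>
          if hi : (i : ℕ) < N then
            if hj : (j : ℕ) < N then m t ⟨i, hi⟩ ⟨j, hj⟩ else φ t ⟨i, hi⟩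
          else
            if hj : (j : ℕ) < N then -ψ t ⟨j, hj⟩ else 0))) t := by
  intro t ht
  convert! Matrix.hasDerivAt_det_of_vecMulVec (hderiv t ht) using 1
  rw [← Matrix.det_submatrix_equiv_self finSumFinEquiv]
  congr 1
  ext (i | i) (j | j) <;> simp
end

section
/- Let R be a commutative ring, N ≥ 1, M an N×N matrix over R, a, b ∈ R^N column vectors and c, d ∈ R^N row vectors. Write B(x,y) for the (N+1)×(N+1) matrix with top-left block M, last column (x,0)ᵀ and last row (y,0), and write T for the (N+2)×(N+2) matrix with top-left block M, last two columns given by a and b (with zeros in the last two rows of these columns), and last two rows given by c and d (with zeros in the last two columns of these rows). Then det T · det M = det B(a,c) · det B(b,d) − det B(b,c) · det B(a,d). -/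
/-- Bordered `(N+1) × (N+1)` matrix: top-left block `M`, last column `(x, 0)ᵀ`,
last row `(y, 0)`. -/
def borderOne {R : Type*} [CommRing R] {N : ℕ} (M : Matrix (Fin N) (Fin N) R)
    (x y : Fin N → R) : Matrix (Fin (N + 1)) (Fin (N + 1)) R :=
  Matrix.of fun i j =>
    if hi : (i : ℕ) < N then
      if hj : (j : ℕ) < N then M ⟨i, hi⟩ ⟨j, hj⟩ else x ⟨i, hi⟩
    else
      if hj : (j : ℕ) < N then y ⟨j, hj⟩ else 0

/-- Doubly bordered `(N+2) × (N+2)` matrix: top-left block `M`, last two columns `a`, `b`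
(with zeros in the last two rows), last two rows `c`, `d` (with zeros in the last two
columns). -/
def borderTwo {R : Type*} [CommRing R] {N : ℕ} (M : Matrix (Fin N) (Fin N) R)
    (a b c d : Fin N → R) : Matrix (Fin (N + 2)) (Fin (N + 2)) R :=
  Matrix.of fun i j =>
    if hi : (i : ℕ) < N then
      if hj : (j : ℕ) < N then M ⟨i, hi⟩ ⟨j, hj⟩
      else if (j : ℕ) = N then a ⟨i, hi⟩ else b ⟨i, hi⟩
    else
      if hj : (j : ℕ) < N then
        if (i : ℕ) = N then c ⟨j, hj⟩ else d ⟨j, hj⟩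
      else 0

namespace Matrix

variable {R S m n : Type*} [CommRing R] [CommRing S] [Fintype m] [Fintype n]
  [DecidableEq m] [DecidableEq n]

/-- Schur complement formula with the inverse replaced by the adjugate. -/
theorem det_fromBlocks_zero_mul_det_pow (M : Matrix n n R) (U : Matrix n m R)
    (V : Matrix m n R) :
    (fromBlocks M U V 0).det * M.det ^ Fintype.card m
      = M.det * (-(V * M.adjugate * U)).det := by
  have h : fromBlocks M U V 0 * fromBlocks 1 (-(M.adjugate * U)) 0 (M.det • (1 : Matrix m m R))
      = fromBlocks M 0 V (-(V * M.adjugate * U)) := by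
    simp [fromBlocks_multiply, ← Matrix.mul_assoc, mul_adjugate]
  simpa [det_mul, det_smul] using congrArg det h

theorem borderOne_det_eq (N : ℕ) (M : Matrix (Fin N) (Fin N) R) (x y : Fin N → R) :
    (borderOne M x y).det
      = (fromBlocks M (of fun i (_ : Fin 1) => x i) (of fun (_ : Fin 1) j => y j) 0).det := by
  rw [← det_submatrix_equiv_self finSumFinEquiv (borderOne M x y)]
  congr 1
  ext (i | i) (j | j) <;> simp [borderOne]

theorem borderTwo_det_eq (N : ℕ) (M : Matrix (Fin N) (Fin N) R) (a b c d : Fin N → R) :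
    (borderTwo M a b c d).det
      = (fromBlocks M (of fun i => ![a i, b i]) (of ![c, d]) 0).det := by
  rw [← det_submatrix_equiv_self finSumFinEquiv (borderTwo M a b c d)]
  congr 1
  ext (i | i) (j | j)
  · simp [borderTwo]
  · fin_cases j <;> simp [borderTwo]
  · fin_cases i <;> simp [borderTwo]
  · simp [borderTwo]

theorem borderOne_map (f : R →+* S) {N : ℕ} (M : Matrix (Fin N) (Fin N) R)
    (x y : Fin N → R) :
    f.mapMatrix (borderOne M x y) = borderOne (f.mapMatrix M) (f ∘ x) (f ∘ y) := by
  ext i j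
  simp only [borderOne, RingHom.mapMatrix_apply, map_apply, of_apply]
  split_ifs <;> simp

theorem borderTwo_map (f : R →+* S) {N : ℕ} (M : Matrix (Fin N) (Fin N) R)
    (a b c d : Fin N → R) :
    f.mapMatrix (borderTwo M a b c d)
      = borderTwo (f.mapMatrix M) (f ∘ a) (f ∘ b) (f ∘ c) (f ∘ d) := by
  ext i j
  simp only [borderTwo, RingHom.mapMatrix_apply, map_apply, of_apply]
  split_ifs <;> simp

theorem borderOne_det_of_isRegular {N : ℕ} {M : Matrix (Fin N) (Fin N) R}
    (hM : IsRegular M.det) (x y : Fin N → R) :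
    (borderOne M x y).det = -(y ᵥ* M.adjugate ⬝ᵥ x) := by
  have h := det_fromBlocks_zero_mul_det_pow M (of fun i (_ : Fin 1) => x i)
    (of fun (_ : Fin 1) j => y j)
  rw [← borderOne_det_eq, Fintype.card_fin, pow_one, mul_comm] at h
  rw [hM.left h, det_fin_one]
  rfl

theorem borderTwo_det_mul_det_of_isRegular {N : ℕ} {M : Matrix (Fin N) (Fin N) R}
    (hM : IsRegular M.det) (a b c d : Fin N → R) :
    (borderTwo M a b c d).det * M.det
      = (c ᵥ* M.adjugate ⬝ᵥ a) * (d ᵥ* M.adjugate ⬝ᵥ b)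
        - (c ᵥ* M.adjugate ⬝ᵥ b) * (d ᵥ* M.adjugate ⬝ᵥ a) := by
  have h := det_fromBlocks_zero_mul_det_pow M (of fun i => ![a i, b i]) (of ![c, d])
  rw [← borderTwo_det_eq, Fintype.card_fin, pow_two, ← mul_assoc, mul_comm] at h
  rw [hM.left h, det_neg, Fintype.card_fin, neg_one_sq, one_mul, det_fin_two]
  rfl

theorem jacobi_identity_bordered_of_isRegular {N : ℕ} {M : Matrix (Fin N) (Fin N) R}
    (hM : IsRegular M.det) (a b c d : Fin N → R) :
    (borderTwo M a b c d).det * M.det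
      = (borderOne M a c).det * (borderOne M b d).det
        - (borderOne M b c).det * (borderOne M a d).det := by
  simp only [borderTwo_det_mul_det_of_isRegular hM, borderOne_det_of_isRegular hM]
  ring

end Matrix

/-- the Jacobi (Desnanot–Jacobi) identity for bordered determinants. -/
theorem jacobi_identity_bordered {R : Type*} [CommRing R] (N : ℕ) (hN : 1 ≤ N)
    (M : Matrix (Fin N) (Fin N) R) (a b c d : Fin N → R) :
    (borderTwo M a b c d).det * M.det
      = (borderOne M a c).det * (borderOne M b d).det
        - (borderOne M b c).det * (borderOne M a d).det := by
  -- The characteristic matrix of `-M` has regular determinant and specializes to `M` at `0`.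
  let ev : Polynomial R →+* R := Polynomial.evalRingHom 0
  have hev : ev.mapMatrix (-M).charmatrix = M := by
    ext i j
    by_cases hij : i = j <;> simp [ev, hij]
  have hC (x : Fin N → R) : ev ∘ (Polynomial.C ∘ x) = x := by
    ext i
    simp [ev]
  have h := congrArg ev (Matrix.jacobi_identity_bordered_of_isRegular
    (M := (-M).charmatrix) (-M).charpoly_monic.isRegular
    (Polynomial.C ∘ a) (Polynomial.C ∘ b) (Polynomial.C ∘ c) (Polynomial.C ∘ d))
  simpa only [map_mul, map_sub, RingHom.map_det, Matrix.borderOne_map, Matrix.borderTwo_map,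
    hev, hC] using h
end

section
/- Let N ≥ 1, m ≥ 1, and let p_{rj}, q_{sk}, η_{0,rj}, ξ_{0,sk}, c_{jk} ∈ ℂ (1 ≤ r,s ≤ m, 1 ≤ j,k ≤ N) be constants such that e^{i p_{rj}} ≠ e^{−i q_{sk}} for all r,s,j,k. Define the entire functions η_{rj}(n,t,y,z) = p_{rj}·n − i e^{i p_{rj}} t − i(e^{−i p_{rj}} + e^{2 i p_{rj}}) y − i e^{2 i p_{rj}} z + η_{0,rj} and ξ_{sk}(n,t,y,z) = q_{sk}·n + i e^{−i q_{sk}} t + i(e^{i q_{sk}} + e^{−2 i q_{sk}}) y + i e^{−2 i q_{sk}} z + ξ_{0,sk}, and set m_{jk} = c_{jk} + Σ_{r,s=1}^{m} [i/(e^{i p_{rj}} − e^{−i q_{sk}})] e^{η_{rj} + ξ_{sk}}. Then τ = det_{1≤j,k≤N}(m_{jk}) satisfies both equations (E1) and (E2) of the variant bilinear Blaszak–Szum system. (The case m = 1, c_{jk} = δ_{jk} gives the N-soliton solution; the case m = 2, N = 1 gives the breather solutions.) -/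
/-- Partial derivative in the second ("t") variable. -/
noncomputable def dT (f : ℂ → ℂ → ℂ → ℂ → ℂ) : ℂ → ℂ → ℂ → ℂ → ℂ :=
  fun n t y z => deriv (fun s => f n s y z) t

/-- Partial derivative in the third ("y") variable. -/
noncomputable def dY (f : ℂ → ℂ → ℂ → ℂ → ℂ) : ℂ → ℂ → ℂ → ℂ → ℂ :=
  fun n t y z => deriv (fun s => f n t s z) y

/-- Partial derivative in the fourth ("z") variable. -/
noncomputable def dZ (f : ℂ → ℂ → ℂ → ℂ → ℂ) : ℂ → ℂ → ℂ → ℂ → ℂ :=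
  fun n t y z => deriv (fun s => f n t y s) z

/-- Entire function of four complex variables. -/
def Entire4 (f : ℂ → ℂ → ℂ → ℂ → ℂ) : Prop :=
  Differentiable ℂ (fun p : ℂ × ℂ × ℂ × ℂ => f p.1 p.2.1 p.2.2.1 p.2.2.2)

/-- The variant bilinear Blaszak–Szum system: equations (E1) and (E2) in shift form. -/
def VariantBS (τ : ℂ → ℂ → ℂ → ℂ → ℂ) : Prop :=
  ∀ n t y z : ℂ,
    ((-Complex.I) * (dZ τ (n + Complex.I) t y z * τ n t y z
        - τ (n + Complex.I) t y z * dZ τ n t y z)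
      = dT (dT τ) (n + Complex.I) t y z * τ n t y z
        - 2 * dT τ (n + Complex.I) t y z * dT τ n t y z
        + τ (n + Complex.I) t y z * dT (dT τ) n t y z)
    ∧ ((dT (dZ τ) n t y z - dT (dY τ) n t y z) * τ n t y z
        - dT τ n t y z * (dZ τ n t y z - dY τ n t y z)
      = τ n t y z ^ 2 - τ (n + Complex.I) t y z * τ (n - Complex.I) t y z)

section

open scoped Matrix

/-- The bilinear form `(v, u) ↦ vᵀ adj(A) u` of the adjugate of a square matrix. -/
def adjForm {ι : Type*} [Fintype ι] [DecidableEq ι] (A : Matrix ι ι ℂ) (v u : ι → ℂ) : ℂ :=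
  v ⬝ᵥ (A.adjugate *ᵥ u)

section Adjugate

variable {ι : Type*} [Fintype ι] [DecidableEq ι]

theorem adjForm_smul_left (A : Matrix ι ι ℂ) (c : ℂ) (v u : ι → ℂ) :
    adjForm A (c • v) u = c * adjForm A v u := by
  simp [adjForm]

theorem adjForm_smul_right (A : Matrix ι ι ℂ) (c : ℂ) (v u : ι → ℂ) :
    adjForm A v (c • u) = c * adjForm A v u := by
  simp [adjForm, Matrix.mulVec_smul]

theorem trace_adjugate_mul_vecMulVec (A : Matrix ι ι ℂ) (u v : ι → ℂ) :
    (A.adjugate * Matrix.vecMulVec u v).trace = adjForm A v u := by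
  rw [Matrix.mul_vecMulVec, Matrix.trace_vecMulVec, adjForm, dotProduct_comm]

theorem dense_det_ne_zero : Dense {A : Matrix ι ι ℂ | A.det ≠ 0} := by
  intro A
  have hdense : Dense {x : ℂ | (-A).charpoly.eval x ≠ 0} := by
    have hfin : {x : ℂ | (-A).charpoly.IsRoot x}.Finite :=
      Polynomial.finite_setOfPred_isRoot (-A).charpoly_monic.ne_zero
    simpa [Set.compl_def] using hfin.countable.dense_compl ℂ
  have hcont : Continuous fun x : ℂ => Matrix.scalar ι x - -A := by
    simp only [Matrix.scalar_apply]
    fun_prop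
  have h0 := map_mem_closure hcont (hdense 0) (t := {A : Matrix ι ι ℂ | A.det ≠ 0})
    fun x hx => by simpa [Matrix.eval_charpoly] using hx
  simpa using h0

theorem eq_of_eq_on_det_ne_zero {f g : Matrix ι ι ℂ → ℂ} (hf : Continuous f) (hg : Continuous g)
    (h : ∀ A : Matrix ι ι ℂ, A.det ≠ 0 → f A = g A) (A : Matrix ι ι ℂ) : f A = g A :=
  congrFun (hf.ext_on dense_det_ne_zero hg h) A

theorem continuous_adjForm (v u : ι → ℂ) :
    Continuous fun A : Matrix ι ι ℂ => adjForm A v u := by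
  unfold adjForm
  fun_prop

/-- The matrix determinant lemma, without any invertibility assumption. -/
theorem det_add_vecMulVec (A : Matrix ι ι ℂ) (u v : ι → ℂ) :
    (A + Matrix.vecMulVec u v).det = A.det + adjForm A v u := by
  refine eq_of_eq_on_det_ne_zero (f := fun A => (A + Matrix.vecMulVec u v).det)
    (g := fun A => A.det + adjForm A v u) (by fun_prop)
    (continuous_id.matrix_det.add (continuous_adjForm v u)) (fun A hA => ?_) A
  have hu : u = A *ᵥ ((A.det)⁻¹ • (A.adjugate *ᵥ u)) := by
    rw [Matrix.mulVec_smul, Matrix.mulVec_mulVec, Matrix.mul_adjugate, Matrix.smul_mulVec,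
      Matrix.one_mulVec, smul_smul, inv_mul_cancel₀ hA, one_smul]
  have hfac : A + Matrix.vecMulVec u v
      = A * (1 + Matrix.vecMulVec ((A.det)⁻¹ • (A.adjugate *ᵥ u)) v) := by
    rw [mul_add, mul_one, Matrix.mul_vecMulVec, ← hu]
  have hone := Matrix.det_one_add_replicateCol_mul_replicateRow (ι := Unit)
    ((A.det)⁻¹ • (A.adjugate *ᵥ u)) v
  rw [← Matrix.vecMulVec_eq] at hone
  simp only [adjForm]
  rw [hfac, Matrix.det_mul, hone, dotProduct_smul, smul_eq_mul]
  field_simp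

/-- The Jacobi identity for a rank-one perturbation. -/
theorem det_mul_adjForm_add_vecMulVec (A : Matrix ι ι ℂ) (u v w x : ι → ℂ) :
    A.det * adjForm (A + Matrix.vecMulVec u v) w x
      = (A + Matrix.vecMulVec u v).det * adjForm A w x - adjForm A w u * adjForm A v x := by
  have key : ∀ B : Matrix ι ι ℂ,
      (B - Matrix.vecMulVec u v).det * adjForm B w x
        = B.det * adjForm (B - Matrix.vecMulVec u v) w x
          - adjForm (B - Matrix.vecMulVec u v) w u * adjForm (B - Matrix.vecMulVec u v) v x := by
    have hc : ∀ a b : ι → ℂ,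
        Continuous fun B : Matrix ι ι ℂ => adjForm (B - Matrix.vecMulVec u v) a b := fun a b =>
      (continuous_adjForm a b).comp (by fun_prop)
    refine eq_of_eq_on_det_ne_zero
      ((Continuous.matrix_det (by fun_prop)).mul (continuous_adjForm w x))
      ((continuous_id.matrix_det.mul (hc w x)).sub ((hc w u).mul (hc v x))) fun B hB => ?_
    obtain ⟨C, hC⟩ : ∃ C, C = B - Matrix.vecMulVec u v := ⟨_, rfl⟩
    have hBC : B = C + Matrix.vecMulVec u v := by rw [hC]; abel
    have hdet := det_add_vecMulVec C u v
    rw [← hBC] at hdet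
    -- Write `x = B y` and compare both sides through `y`.
    obtain ⟨y, rfl⟩ : ∃ y, x = B *ᵥ y := ⟨(B.det)⁻¹ • (B.adjugate *ᵥ x), by
      rw [Matrix.mulVec_smul, Matrix.mulVec_mulVec, Matrix.mul_adjugate, Matrix.smul_mulVec,
        Matrix.one_mulVec, smul_smul, inv_mul_cancel₀ hB, one_smul]⟩
    have hBy : ∀ a, adjForm B a (B *ᵥ y) = B.det * (a ⬝ᵥ y) := fun a => by
      rw [adjForm, Matrix.mulVec_mulVec, Matrix.adjugate_mul, Matrix.smul_mulVec,
        Matrix.one_mulVec, dotProduct_smul, smul_eq_mul]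
    have hCy : ∀ a, adjForm C a (B *ᵥ y) = C.det * (a ⬝ᵥ y) + adjForm C a u * (v ⬝ᵥ y) :=
      fun a => by
        rw [hBC, Matrix.add_mulVec, Matrix.vecMulVec_mulVec]
        simp [adjForm, Matrix.mulVec_add, Matrix.mulVec_mulVec, Matrix.adjugate_mul,
          Matrix.smul_mulVec, Matrix.mulVec_smul, mul_comm]
    rw [← hC, hBy, hCy, hCy, hdet]
    ring
  simpa using key (A + Matrix.vecMulVec u v)

theorem adjForm_add_vecMulVec_left (A : Matrix ι ι ℂ) (u v x : ι → ℂ) :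
    adjForm (A + Matrix.vecMulVec u v) v x = adjForm A v x := by
  refine eq_of_eq_on_det_ne_zero (f := fun A => adjForm (A + Matrix.vecMulVec u v) v x)
    ((continuous_adjForm v x).comp (by fun_prop)) (continuous_adjForm v x) (fun A hA => ?_) A
  have h := det_mul_adjForm_add_vecMulVec A u v v x
  rw [det_add_vecMulVec] at h
  exact mul_left_cancel₀ hA (by linear_combination h)

theorem adjForm_add_vecMulVec_right (A : Matrix ι ι ℂ) (u v w : ι → ℂ) :
    adjForm (A + Matrix.vecMulVec u v) w u = adjForm A w u := by
  refine eq_of_eq_on_det_ne_zero (f := fun A => adjForm (A + Matrix.vecMulVec u v) w u)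
    ((continuous_adjForm w u).comp (by fun_prop)) (continuous_adjForm w u) (fun A hA => ?_) A
  have h := det_mul_adjForm_add_vecMulVec A u v w u
  rw [det_add_vecMulVec] at h
  exact mul_left_cancel₀ hA (by linear_combination h)

/-- Jacobi's formula for the derivative of a determinant. -/
theorem hasDerivAt_det {A : ℂ → Matrix ι ι ℂ} {A' : Matrix ι ι ℂ} {t : ℂ}
    (hA : ∀ j k, HasDerivAt (fun s => A s j k) (A' j k) t) :
    HasDerivAt (fun s => (A s).det) ((A t).adjugate * A').trace t := by
  have h : HasDerivAt (fun s => (A s).det)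
      (∑ σ : Equiv.Perm ι, (Equiv.Perm.sign σ : ℂ) *
        ∑ i, (∏ j ∈ Finset.univ.erase i, A t (σ j) j) • A' (σ i) i) t := by
    simp only [Matrix.det_apply']
    exact HasDerivAt.fun_sum fun σ _ =>
      (HasDerivAt.fun_finsetProd fun i _ => hA (σ i) i).const_mul _
  convert h using 1
  have htrace : ((A t).adjugate * A').trace = ∑ i, ((A t).updateCol i fun j => A' j i).det := by
    refine Finset.sum_congr rfl fun i _ => ?_
    rw [← Matrix.cramer_apply, Matrix.cramer_eq_adjugate_mulVec]
    rfl
  simp_rw [htrace, Matrix.det_apply', Finset.mul_sum]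
  rw [Finset.sum_comm]
  refine Finset.sum_congr rfl fun σ _ => Finset.sum_congr rfl fun i _ => ?_
  rw [← Finset.mul_prod_erase _ _ (Finset.mem_univ i), Matrix.updateCol_self, smul_eq_mul,
    mul_comm (A' (σ i) i)]
  congr 2
  exact Finset.prod_congr rfl fun j hj => by rw [Matrix.updateCol_ne (Finset.ne_of_mem_erase hj)]

/-- The derivative of `vᵀ adj(A) u` when `A` moves in a rank-one direction. -/
theorem hasDerivAt_adjForm {A : ℂ → Matrix ι ι ℂ} {a b : ℂ → ι → ℂ} {u v da db : ι → ℂ}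
    {t : ℂ}
    (hA : ∀ j k, HasDerivAt (fun s => A s j k) (Matrix.vecMulVec u v j k) t)
    (ha : ∀ j, HasDerivAt (fun s => a s j) (da j) t)
    (hb : ∀ k, HasDerivAt (fun s => b s k) (db k) t) :
    HasDerivAt (fun s => adjForm (A s) (b s) (a s))
      (adjForm (A t + Matrix.vecMulVec (a t) (b t)) v u - adjForm (A t) v u
        + adjForm (A t) (b t) da + adjForm (A t) db (a t)) t := by
  have hsum : ∀ j k, HasDerivAt (fun s => (A s + Matrix.vecMulVec (a s) (b s)) j k)
      ((Matrix.vecMulVec u v + Matrix.vecMulVec da (b t) + Matrix.vecMulVec (a t) db) j k) t := by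
    intro j k
    simpa [Matrix.vecMulVec_apply, add_assoc] using (hA j k).fun_add ((ha j).fun_mul (hb k))
  have h := (hasDerivAt_det hsum).sub (hasDerivAt_det hA)
  have hfun : (fun s => adjForm (A s) (b s) (a s))
      = fun s => (A s + Matrix.vecMulVec (a s) (b s)).det - (A s).det := by
    funext s
    rw [det_add_vecMulVec]
    ring
  rw [hfun]
  refine h.congr_deriv ?_
  simp only [mul_add, Matrix.trace_add, trace_adjugate_mul_vecMulVec, adjForm_add_vecMulVec_left,
    adjForm_add_vecMulVec_right]
  ring

end Adjugate

/-- A Gram-type determinant whose matrix entries satisfy the rank-one derivative and shift rules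
solves the variant bilinear Blaszak–Szum system. -/
theorem variantBS_det {ι : Type*} [Fintype ι] [DecidableEq ι]
    (M : ℂ → ℂ → ℂ → ℂ → Matrix ι ι ℂ) (u v : ℤ → ℂ → ℂ → ℂ → ℂ → ι → ℂ)
    (hMt : ∀ n t y z j k, HasDerivAt (fun s => M n s y z j k)
      (Matrix.vecMulVec (u 0 n t y z) (v 0 n t y z) j k) t)
    (hMy : ∀ n t y z j k, HasDerivAt (fun s => M n t s z j k)
      ((Matrix.vecMulVec (u 1 n t y z) (v 0 n t y z) + Matrix.vecMulVec (u 0 n t y z) (v 1 n t y z)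
        - Matrix.vecMulVec (u (-1) n t y z) (v (-1) n t y z)) j k) y)
    (hMz : ∀ n t y z j k, HasDerivAt (fun s => M n t y s j k)
      ((Matrix.vecMulVec (u 1 n t y z) (v 0 n t y z)
        + Matrix.vecMulVec (u 0 n t y z) (v 1 n t y z)) j k) z)
    (hu : ∀ l n t y z j, HasDerivAt (fun s => u l n s y z j)
      ((-Complex.I • u (l + 1) n t y z) j) t)
    (hv : ∀ l n t y z k, HasDerivAt (fun s => v l n s y z k)
      ((Complex.I • v (l + 1) n t y z) k) t)
    (hu_shift : ∀ l n t y z, u l (n + Complex.I) t y z = u (l + 1) n t y z)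
    (hv_shift : ∀ l n t y z, v l (n + Complex.I) t y z = v (l - 1) n t y z)
    (hM_add : ∀ n t y z, M (n + Complex.I) t y z
      = M n t y z + Matrix.vecMulVec (u 0 n t y z) (Complex.I • v (-1) n t y z))
    (hM_sub : ∀ n t y z, M (n - Complex.I) t y z
      = M n t y z + Matrix.vecMulVec (u (-1) n t y z) (-Complex.I • v 0 n t y z)) :
    VariantBS fun n t y z => (M n t y z).det := by
  obtain ⟨F, hF⟩ : ∃ F : ℤ → ℤ → ℂ → ℂ → ℂ → ℂ → ℂ, F = fun k l n t y z =>
    adjForm (M n t y z) (v k n t y z) (u l n t y z) := ⟨_, rfl⟩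
  have hFt : ∀ k l n t y z, HasDerivAt (fun s => F k l n s y z)
      (adjForm (M n t y z + Matrix.vecMulVec (u l n t y z) (v k n t y z)) (v 0 n t y z)
          (u 0 n t y z)
        - F 0 0 n t y z - Complex.I * F k (l + 1) n t y z
        + Complex.I * F (k + 1) l n t y z) t := by
    intro k l n t y z
    simp only [hF]
    refine (hasDerivAt_adjForm (hMt n t y z) (hu l n t y z) (hv k n t y z)).congr_deriv ?_
    rw [adjForm_smul_left, adjForm_smul_right]
    ring
  have hT : dT (fun n t y z => (M n t y z).det) = F 0 0 := by
    funext n t y z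
    exact (hasDerivAt_det (hMt n t y z)).deriv.trans
      (by rw [trace_adjugate_mul_vecMulVec, hF])
  have hZ : dZ (fun n t y z => (M n t y z).det)
      = fun n t y z => F 0 1 n t y z + F 1 0 n t y z := by
    funext n t y z
    exact (hasDerivAt_det (hMz n t y z)).deriv.trans
      (by rw [mul_add, Matrix.trace_add, trace_adjugate_mul_vecMulVec,
        trace_adjugate_mul_vecMulVec, hF])
  have hY : dY (fun n t y z => (M n t y z).det)
      = fun n t y z => F 0 1 n t y z + F 1 0 n t y z - F (-1) (-1) n t y z := by
    funext n t y z
    exact (hasDerivAt_det (hMy n t y z)).deriv.trans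
      (by rw [mul_sub, mul_add, Matrix.trace_sub, Matrix.trace_add, trace_adjugate_mul_vecMulVec,
        trace_adjugate_mul_vecMulVec, trace_adjugate_mul_vecMulVec, hF])
  have hTT : ∀ n t y z, dT (F 0 0) n t y z
      = Complex.I * F 1 0 n t y z - Complex.I * F 0 1 n t y z := by
    intro n t y z
    refine (hFt 0 0 n t y z).deriv.trans ?_
    rw [adjForm_add_vecMulVec_left]
    simp only [hF, zero_add]
    ring
  have hTZY : ∀ n t y z,
      dT (fun n t y z => F 0 1 n t y z + F 1 0 n t y z) n t y z
        - dT (fun n t y z => F 0 1 n t y z + F 1 0 n t y z - F (-1) (-1) n t y z) n t y z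
      = adjForm (M n t y z + Matrix.vecMulVec (u (-1) n t y z) (v (-1) n t y z)) (v 0 n t y z)
          (u 0 n t y z)
        - F 0 0 n t y z - Complex.I * F (-1) 0 n t y z + Complex.I * F 0 (-1) n t y z := by
    intro n t y z
    have h := (hFt 0 1 n t y z).fun_add (hFt 1 0 n t y z)
    have h' := hFt (-1) (-1) n t y z
    simp only [dT]
    rw [h.deriv, (h.fun_sub h').deriv, neg_add_cancel]
    ring
  have hF_shift : ∀ k l n t y z, F k l (n + Complex.I) t y z
      = adjForm (M n t y z + Matrix.vecMulVec (u 0 n t y z) (Complex.I • v (-1) n t y z))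
          (v (k - 1) n t y z) (u (l + 1) n t y z) := by
    intro k l n t y z
    simp only [hF, hu_shift, hv_shift, hM_add]
  intro n t y z
  have hdet := det_add_vecMulVec (M n t y z) (u 0 n t y z) (Complex.I • v (-1) n t y z)
  rw [adjForm_smul_left] at hdet
  refine ⟨?_, ?_⟩
  · rw [hT, hZ, hTT, hTT]
    simp only [hF_shift, hM_add]
    norm_num only
    have hJ := det_mul_adjForm_add_vecMulVec (M n t y z) (u 0 n t y z)
      (Complex.I • v (-1) n t y z) (v 0 n t y z) (u 1 n t y z)
    have hL := adjForm_add_vecMulVec_left (M n t y z) (u 0 n t y z)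
      (Complex.I • v (-1) n t y z) (u 1 n t y z)
    rw [adjForm_smul_left] at hJ
    rw [adjForm_smul_left, adjForm_smul_left] at hL
    have hL' := mul_left_cancel₀ Complex.I_ne_zero hL
    rw [hL']
    simp only [hF]
    linear_combination (-2 * Complex.I) * hJ + (2 * adjForm (M n t y z) (v 0 n t y z)
      (u 0 n t y z) * adjForm (M n t y z) (v (-1) n t y z) (u 1 n t y z)) * Complex.I_sq
  · rw [hT, hZ, hY, hTZY]
    have hdet' := det_add_vecMulVec (M n t y z) (u (-1) n t y z) (-Complex.I • v 0 n t y z)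
    rw [adjForm_smul_left] at hdet'
    have hJ := det_mul_adjForm_add_vecMulVec (M n t y z) (u (-1) n t y z) (v (-1) n t y z)
      (v 0 n t y z) (u 0 n t y z)
    rw [det_add_vecMulVec] at hJ
    simp only [hM_add, hM_sub, hdet, hdet', hF]
    linear_combination hJ - adjForm (M n t y z) (v (-1) n t y z) (u 0 n t y z)
      * adjForm (M n t y z) (v 0 n t y z) (u (-1) n t y z) * Complex.I_sq

end

theorem hasDerivAt_of_eq_mul_add {f : ℂ → ℂ} {a b x : ℂ} (h : ∀ s, f s = a * s + b) :
    HasDerivAt f a x := by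
  rw [funext h]
  simpa using ((hasDerivAt_id x).const_mul a).add_const b

/-- The phase `η` attached to a wave number `p`. -/
noncomputable def etaPhase (p e n t y z : ℂ) : ℂ :=
  p * n - Complex.I * Complex.exp (Complex.I * p) * t
    - Complex.I * (Complex.exp (-Complex.I * p) + Complex.exp (2 * Complex.I * p)) * y
    - Complex.I * Complex.exp (2 * Complex.I * p) * z + e

/-- The phase `ξ` attached to a wave number `q`. -/
noncomputable def xiPhase (q e n t y z : ℂ) : ℂ :=
  q * n + Complex.I * Complex.exp (-Complex.I * q) * t
    + Complex.I * (Complex.exp (Complex.I * q) + Complex.exp (-2 * Complex.I * q)) * y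
    + Complex.I * Complex.exp (-2 * Complex.I * q) * z + e

section Phases

variable (p q e n t y z : ℂ)

theorem etaPhase_eq : etaPhase p e n t y z
    = p * n - Complex.I * Complex.exp (Complex.I * p) * t
      - Complex.I * ((Complex.exp (Complex.I * p))⁻¹ + Complex.exp (Complex.I * p) ^ 2) * y
      - Complex.I * Complex.exp (Complex.I * p) ^ 2 * z + e := by
  rw [etaPhase, neg_mul, Complex.exp_neg, ← Complex.exp_nat_mul, mul_assoc 2]
  norm_num

theorem xiPhase_eq : xiPhase q e n t y z
    = q * n + Complex.I * Complex.exp (-Complex.I * q) * t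
      + Complex.I * ((Complex.exp (-Complex.I * q))⁻¹ + Complex.exp (-Complex.I * q) ^ 2) * y
      + Complex.I * Complex.exp (-Complex.I * q) ^ 2 * z + e := by
  rw [xiPhase, ← Complex.exp_neg, ← Complex.exp_nat_mul, neg_mul Complex.I, neg_neg]
  norm_num [mul_assoc]

theorem exp_etaPhase_add_I : Complex.exp (etaPhase p e (n + Complex.I) t y z)
    = Complex.exp (Complex.I * p) * Complex.exp (etaPhase p e n t y z) := by
  rw [← Complex.exp_add]
  congr 1
  simp only [etaPhase]
  ring

theorem exp_xiPhase_add_I : Complex.exp (xiPhase q e (n + Complex.I) t y z)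
    = (Complex.exp (-Complex.I * q))⁻¹ * Complex.exp (xiPhase q e n t y z) := by
  rw [← Complex.exp_neg, ← Complex.exp_add]
  congr 1
  simp only [xiPhase]
  ring

theorem exp_etaPhase_sub_I : Complex.exp (etaPhase p e (n - Complex.I) t y z)
    = (Complex.exp (Complex.I * p))⁻¹ * Complex.exp (etaPhase p e n t y z) := by
  rw [← Complex.exp_neg, ← Complex.exp_add]
  congr 1
  simp only [etaPhase]
  ring

theorem exp_xiPhase_sub_I : Complex.exp (xiPhase q e (n - Complex.I) t y z)
    = Complex.exp (-Complex.I * q) * Complex.exp (xiPhase q e n t y z) := by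
  rw [← Complex.exp_add]
  congr 1
  simp only [xiPhase]
  ring

theorem hasDerivAt_etaPhase_t : HasDerivAt (fun s => etaPhase p e n s y z)
    (-Complex.I * Complex.exp (Complex.I * p)) t :=
  hasDerivAt_of_eq_mul_add (b := etaPhase p e n 0 y z) fun s => by
    simp only [etaPhase]
    ring

theorem hasDerivAt_etaPhase_y : HasDerivAt (fun s => etaPhase p e n t s z)
    (-Complex.I * ((Complex.exp (Complex.I * p))⁻¹ + Complex.exp (Complex.I * p) ^ 2)) y :=
  hasDerivAt_of_eq_mul_add (b := etaPhase p e n t 0 z) fun s => by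
    simp only [etaPhase_eq]
    ring

theorem hasDerivAt_etaPhase_z : HasDerivAt (fun s => etaPhase p e n t y s)
    (-Complex.I * Complex.exp (Complex.I * p) ^ 2) z :=
  hasDerivAt_of_eq_mul_add (b := etaPhase p e n t y 0) fun s => by
    simp only [etaPhase_eq]
    ring

theorem hasDerivAt_xiPhase_t : HasDerivAt (fun s => xiPhase q e n s y z)
    (Complex.I * Complex.exp (-Complex.I * q)) t :=
  hasDerivAt_of_eq_mul_add (b := xiPhase q e n 0 y z) fun s => by
    simp only [xiPhase]
    ring

theorem hasDerivAt_xiPhase_y : HasDerivAt (fun s => xiPhase q e n t s z)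
    (Complex.I * ((Complex.exp (-Complex.I * q))⁻¹ + Complex.exp (-Complex.I * q) ^ 2)) y :=
  hasDerivAt_of_eq_mul_add (b := xiPhase q e n t 0 z) fun s => by
    simp only [xiPhase_eq]
    ring

theorem hasDerivAt_xiPhase_z : HasDerivAt (fun s => xiPhase q e n t y s)
    (Complex.I * Complex.exp (-Complex.I * q) ^ 2) z :=
  hasDerivAt_of_eq_mul_add (b := xiPhase q e n t y 0) fun s => by
    simp only [xiPhase_eq]
    ring

end Phases

theorem hasDerivAt_add_sum_sum_mul_exp {α β : Type*} [Fintype α] [Fintype β]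
    (c : ℂ) (a : α → β → ℂ) {f : α → ℂ → ℂ} {g : β → ℂ → ℂ} {f' : α → ℂ} {g' : β → ℂ} {x : ℂ}
    (hf : ∀ r, HasDerivAt (f r) (f' r) x) (hg : ∀ s, HasDerivAt (g s) (g' s) x) :
    HasDerivAt (fun w => c + ∑ r, ∑ s, a r s * Complex.exp (f r w + g s w))
      (∑ r, ∑ s, a r s * (f' r + g' s) * (Complex.exp (f r x) * Complex.exp (g s x))) x := by
  refine (HasDerivAt.fun_sum fun r _ => HasDerivAt.fun_sum fun s _ =>
    (((hf r).fun_add (hg s)).cexp.const_mul (a r s)).congr_deriv ?_).const_add c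
  rw [Complex.exp_add]
  ring

/-- the Gram determinant built from sums of exponentials solves the variant
bilinear Blaszak–Szum system (m = 1 gives the N-soliton, m = 2, N = 1 the breathers). -/
theorem soliton_breather_tau_solves_variantBS (N m : ℕ) (hN : 1 ≤ N) (hm : 1 ≤ m)
    (p q η0 ξ0 : Fin m → Fin N → ℂ) (c : Fin N → Fin N → ℂ)
    (hpq : ∀ (r s : Fin m) (j k : Fin N),
      Complex.exp (Complex.I * p r j) ≠ Complex.exp (-Complex.I * q s k)) :
    VariantBS (fun n t y z =>
      Matrix.det (Matrix.of (fun j k : Fin N =>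
        c j k + ∑ r : Fin m, ∑ s : Fin m,
          Complex.I / (Complex.exp (Complex.I * p r j) - Complex.exp (-Complex.I * q s k)) *
            Complex.exp (
              (p r j * n - Complex.I * Complex.exp (Complex.I * p r j) * t
                - Complex.I * (Complex.exp (-Complex.I * p r j)
                    + Complex.exp (2 * Complex.I * p r j)) * y
                - Complex.I * Complex.exp (2 * Complex.I * p r j) * z + η0 r j)
              + (q s k * n + Complex.I * Complex.exp (-Complex.I * q s k) * t
                + Complex.I * (Complex.exp (Complex.I * q s k)
                    + Complex.exp (-2 * Complex.I * q s k)) * y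
                + Complex.I * Complex.exp (-2 * Complex.I * q s k) * z + ξ0 s k)))))  := by
  refine variantBS_det (fun n t y z => Matrix.of fun j k => c j k + ∑ r, ∑ s,
      Complex.I / (Complex.exp (Complex.I * p r j) - Complex.exp (-Complex.I * q s k)) *
        Complex.exp (etaPhase (p r j) (η0 r j) n t y z + xiPhase (q s k) (ξ0 s k) n t y z))
    (fun l n t y z j => ∑ r, Complex.exp (Complex.I * p r j) ^ l *
      Complex.exp (etaPhase (p r j) (η0 r j) n t y z))
    (fun l n t y z k => ∑ s, Complex.exp (-Complex.I * q s k) ^ l *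
      Complex.exp (xiPhase (q s k) (ξ0 s k) n t y z))
    ?_ ?_ ?_ ?_ ?_ ?_ ?_ ?_ ?_
  · intro n t y z j k
    refine (hasDerivAt_add_sum_sum_mul_exp (c j k) _
      (fun r => hasDerivAt_etaPhase_t (p r j) (η0 r j) n t y z)
      (fun s => hasDerivAt_xiPhase_t (q s k) (ξ0 s k) n t y z)).congr_deriv ?_
    simp only [Matrix.vecMulVec_apply, Finset.sum_mul_sum, zpow_zero, one_mul]
    refine Finset.sum_congr rfl fun r _ => Finset.sum_congr rfl fun s _ => ?_
    have hne := sub_ne_zero.mpr (hpq r s j k)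
    generalize Complex.exp (Complex.I * p r j) = P at *
    generalize Complex.exp (-Complex.I * q s k) = Q at *
    field_simp
    linear_combination (Q - P) * Complex.I_sq
  · intro n t y z j k
    refine (hasDerivAt_add_sum_sum_mul_exp (c j k) _
      (fun r => hasDerivAt_etaPhase_y (p r j) (η0 r j) n t y z)
      (fun s => hasDerivAt_xiPhase_y (q s k) (ξ0 s k) n t y z)).congr_deriv ?_
    simp only [Matrix.sub_apply, Matrix.add_apply, Matrix.vecMulVec_apply, Finset.sum_mul_sum,
      ← Finset.sum_add_distrib, ← Finset.sum_sub_distrib, zpow_zero, zpow_one, one_mul, zpow_neg]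
    refine Finset.sum_congr rfl fun r _ => Finset.sum_congr rfl fun s _ => ?_
    have hne := sub_ne_zero.mpr (hpq r s j k)
    have hP := Complex.exp_ne_zero (Complex.I * p r j)
    have hQ := Complex.exp_ne_zero (-Complex.I * q s k)
    generalize Complex.exp (Complex.I * p r j) = P at *
    generalize Complex.exp (-Complex.I * q s k) = Q at *
    field_simp
    rw [Complex.I_sq]
    ring
  · intro n t y z j k
    refine (hasDerivAt_add_sum_sum_mul_exp (c j k) _
      (fun r => hasDerivAt_etaPhase_z (p r j) (η0 r j) n t y z)
      (fun s => hasDerivAt_xiPhase_z (q s k) (ξ0 s k) n t y z)).congr_deriv ?_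
    simp only [Matrix.add_apply, Matrix.vecMulVec_apply, Finset.sum_mul_sum,
      ← Finset.sum_add_distrib, zpow_zero, zpow_one, one_mul]
    refine Finset.sum_congr rfl fun r _ => Finset.sum_congr rfl fun s _ => ?_
    have hne := sub_ne_zero.mpr (hpq r s j k)
    generalize Complex.exp (Complex.I * p r j) = P at *
    generalize Complex.exp (-Complex.I * q s k) = Q at *
    field_simp
    rw [Complex.I_sq]
    ring
  · intro l n t y z j
    refine (HasDerivAt.fun_sum fun r _ =>
      (hasDerivAt_etaPhase_t (p r j) (η0 r j) n t y z).cexp.const_mul _).congr_deriv ?_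
    simp only [Pi.smul_apply, smul_eq_mul, Finset.mul_sum]
    refine Finset.sum_congr rfl fun r _ => ?_
    rw [zpow_add_one₀ (Complex.exp_ne_zero _)]
    ring
  · intro l n t y z k
    refine (HasDerivAt.fun_sum fun s _ =>
      (hasDerivAt_xiPhase_t (q s k) (ξ0 s k) n t y z).cexp.const_mul _).congr_deriv ?_
    simp only [Pi.smul_apply, smul_eq_mul, Finset.mul_sum]
    refine Finset.sum_congr rfl fun s _ => ?_
    rw [zpow_add_one₀ (Complex.exp_ne_zero _)]
    ring
  · intro l n t y z
    funext j
    refine Finset.sum_congr rfl fun r _ => ?_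
    rw [exp_etaPhase_add_I, zpow_add_one₀ (Complex.exp_ne_zero _), mul_assoc]
  · intro l n t y z
    funext k
    refine Finset.sum_congr rfl fun s _ => ?_
    rw [exp_xiPhase_add_I, zpow_sub_one₀ (Complex.exp_ne_zero _), mul_assoc]
  · intro n t y z
    ext j k
    simp only [Matrix.of_apply, Matrix.add_apply, Matrix.vecMulVec_apply, Pi.smul_apply,
      smul_eq_mul, mul_left_comm _ Complex.I, Finset.sum_mul_sum, add_assoc]
    simp only [Finset.mul_sum, ← Finset.sum_add_distrib]
    congr 1
    refine Finset.sum_congr rfl fun r _ => Finset.sum_congr rfl fun s _ => ?_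
    rw [Complex.exp_add, Complex.exp_add, exp_etaPhase_add_I, exp_xiPhase_add_I]
    have hne := sub_ne_zero.mpr (hpq r s j k)
    have hQ := Complex.exp_ne_zero (-Complex.I * q s k)
    generalize Complex.exp (Complex.I * p r j) = P at *
    generalize Complex.exp (-Complex.I * q s k) = Q at *
    rw [zpow_zero, zpow_neg_one]
    field_simp
    ring
  · intro n t y z
    ext j k
    simp only [Matrix.of_apply, Matrix.add_apply, Matrix.vecMulVec_apply, Pi.smul_apply,
      smul_eq_mul, mul_left_comm _ (-Complex.I), Finset.sum_mul_sum, add_assoc]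
    simp only [Finset.mul_sum, ← Finset.sum_add_distrib]
    congr 1
    refine Finset.sum_congr rfl fun r _ => Finset.sum_congr rfl fun s _ => ?_
    rw [Complex.exp_add, Complex.exp_add, exp_etaPhase_sub_I, exp_xiPhase_sub_I]
    have hne := sub_ne_zero.mpr (hpq r s j k)
    have hP := Complex.exp_ne_zero (Complex.I * p r j)
    generalize Complex.exp (Complex.I * p r j) = P at *
    generalize Complex.exp (-Complex.I * q s k) = Q at *
    rw [zpow_zero, zpow_neg_one]
    field_simp
    ring
end

section
/- Let a ∈ ℝ with sin a > 0 and set K = 1/(2 sin a). Then for every ζ ∈ ℝ: (1 + K e^{ζ} e^{2ia})(1 + K e^{ζ} e^{−2ia}) / (1 + K e^{ζ})² = 1 − (1 − cos 2a)/(1 + cosh(ζ − ln(2 sin a))). In particular the left-hand side is real, and this is the dark one-soliton profile u(n) = τ(n+i)τ(n−i)/τ(n)² of the variant Blaszak–Szum lattice corresponding to the one-soliton tau function τ = 1 + K e^{ζ}. -/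
theorem one_add_mul_exp_mul_one_add_mul_exp_neg (x θ : ℂ) :
    (1 + x * Complex.exp (θ * Complex.I)) * (1 + x * Complex.exp (-(θ * Complex.I)))
      = 1 + 2 * x * Complex.cos θ + x ^ 2 := by
  have hmul : Complex.exp (θ * Complex.I) * Complex.exp (-(θ * Complex.I)) = 1 := by
    rw [← Complex.exp_add, add_neg_cancel, Complex.exp_zero]
  have hcos := Complex.two_cos θ
  rw [neg_mul] at hcos
  linear_combination x ^ 2 * hmul - x * hcos

theorem one_add_two_mul_add_sq_div_one_add_sq {x : ℝ} (hx : 0 < x) (c : ℝ) :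
    (1 + 2 * x * c + x ^ 2) / (1 + x) ^ 2 = 1 - (1 - c) / (1 + (x + x⁻¹) / 2) := by
  have hden : 1 + (x + x⁻¹) / 2 = (1 + x) ^ 2 / (2 * x) := by
    field_simp
    ring
  rw [hden]
  field_simp
  ring

/-- the dark one-soliton profile of the variant Blaszak–Szum lattice:
for `K = 1/(2 sin a)` with `sin a > 0`, the ratio
`(1 + K e^ζ e^{2ia})(1 + K e^ζ e^{−2ia})/(1 + K e^ζ)²` is the real number
`1 − (1 − cos 2a)/(1 + cosh(ζ − ln(2 sin a)))`. -/
theorem dark_one_soliton_profile (a : ℝ) (ha : 0 < Real.sin a)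
    (K : ℝ) (hK : K = 1 / (2 * Real.sin a)) :
    ∀ ζ : ℝ,
      ((1 + (K : ℂ) * (Real.exp ζ : ℂ) * Complex.exp (2 * Complex.I * (a : ℂ)))
          * (1 + (K : ℂ) * (Real.exp ζ : ℂ) * Complex.exp (-(2 * Complex.I * (a : ℂ)))))
        / (1 + (K : ℂ) * (Real.exp ζ : ℂ)) ^ 2
      = ((1 - (1 - Real.cos (2 * a))
            / (1 + Real.cosh (ζ - Real.log (2 * Real.sin a))) : ℝ) : ℂ) := by
  intro ζ
  have hx : 0 < K * Real.exp ζ := by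
    rw [hK]
    positivity
  have hexp : Real.exp (ζ - Real.log (2 * Real.sin a)) = K * Real.exp ζ := by
    rw [Real.exp_sub, Real.exp_log (by positivity), hK]
    ring
  have hphase : 2 * Complex.I * (a : ℂ) = ((2 * a : ℝ) : ℂ) * Complex.I := by
    push_cast
    ring
  rw [Real.cosh_eq, Real.exp_neg, hexp, ← one_add_two_mul_add_sq_div_one_add_sq hx, hphase,
    one_add_mul_exp_mul_one_add_mul_exp_neg]
  push_cast
  rfl
end

section
/- Let s = sin 1, c = 1/(2s), |Z|² = e^{−2} + e^{1/2} − 2 e^{−3/4} cos 2, K = 1/(4s²) + 1/|Z|², and Ω = ln K. For σ ∈ {−1,0,1} define T_σ : ℝ² → ℂ by T_σ(ζ₁,ζ₂) = 1 + K e^{ζ₁+ζ₂+4iσ} + c e^{ζ₁+2iσ} + c e^{ζ₂+2iσ}, and set U(ζ₁,ζ₂) = T_1(ζ₁,ζ₂)·T_{−1}(ζ₁,ζ₂)/T_0(ζ₁,ζ₂)². Then U is real-valued, and for every fixed ζ₁ ∈ ℝ: (i) U(ζ₁,ζ₂) → 1 − (1 − cos 2)/(1 + cosh(ζ₁ − ln(2s)))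 as ζ₂ → −∞, and (ii) U(ζ₁,ζ₂) → 1 − (1 − cos 2)/(1 + cosh(ζ₁ + ln(2s) + Ω)) as ζ₂ → +∞. Thus the soliton traveling along ζ₁ emerges from the collision with the same sech-type profile, shifted in phase by Ω: the collision is elastic. -/
/-- The value of `(A + B w + D w²)(A + B w⁻¹ + D w⁻²) / (A + B + D)²` for a unit complex
number `w` with real part `C`. -/
noncomputable def solitonRatio (C A B D : ℝ) : ℝ :=
  (A ^ 2 + B ^ 2 + D ^ 2 + A * D * (4 * C ^ 2 - 2) + 2 * C * B * (A + D)) / (A + B + D) ^ 2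

theorem solitonRatio_eq_complex {w v : ℂ} {C : ℝ} (hwv : w * v = 1) (hC : w + v = 2 * (C : ℂ))
    (A B D : ℝ) :
    ((A : ℂ) + B * w + D * w ^ 2) * (A + B * v + D * v ^ 2) / ((A : ℂ) + B + D) ^ 2
      = (solitonRatio C A B D : ℂ) := by
  unfold solitonRatio
  push_cast
  congr 1
  linear_combination
    ((B : ℂ) ^ 2 + D ^ 2 * (w * v + 1) + B * D * (w + v) - 2 * A * D) * hwv
      + (A * D * (w + v + 2 * C) + A * B + B * D) * hC

theorem solitonRatio_smul (C A B D : ℝ) {r : ℝ} (hr : r ≠ 0) :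
    solitonRatio C (r * A) (r * B) (r * D) = solitonRatio C A B D := by
  unfold solitonRatio
  rw [← mul_div_mul_left _ ((A + B + D) ^ 2) (pow_ne_zero 2 hr)]
  congr 1 <;> ring

theorem tendsto_solitonRatio {α : Type*} {l : Filter α} (C : ℝ) {f g h : α → ℝ} {A B D : ℝ}
    (hf : Filter.Tendsto f l (nhds A)) (hg : Filter.Tendsto g l (nhds B))
    (hh : Filter.Tendsto h l (nhds D)) (hne : A + B + D ≠ 0) :
    Filter.Tendsto (fun x => solitonRatio C (f x) (g x) (h x)) l
      (nhds (solitonRatio C A B D)) := by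
  unfold solitonRatio
  refine Filter.Tendsto.div ?_ (((hf.add hg).add hh).pow 2) (pow_ne_zero 2 hne)
  exact ((((hf.pow 2).add (hg.pow 2)).add (hh.pow 2)).add ((hf.mul hh).mul_const _)).add
    ((hg.const_mul (2 * C)).mul (hf.add hh))

theorem sechProfile_eq (C : ℝ) {p q : ℝ} (hp : 0 < p) (hq : 0 < q) :
    (p ^ 2 + q ^ 2 + 2 * C * p * q) / (p + q) ^ 2
      = 1 - (1 - C) / (1 + Real.cosh (Real.log (q / p))) := by
  have hcosh : 1 + Real.cosh (Real.log (q / p)) = (p + q) ^ 2 / (2 * p * q) := by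
    rw [Real.cosh_log (div_pos hq hp)]
    field_simp
    ring
  have hpq : p + q ≠ 0 := (add_pos hp hq).ne'
  rw [hcosh]
  field_simp
  ring

theorem solitonRatio_right_zero (C : ℝ) {A B : ℝ} (hA : 0 < A) (hB : 0 < B) :
    solitonRatio C A B 0 = 1 - (1 - C) / (1 + Real.cosh (Real.log (B / A))) := by
  rw [← sechProfile_eq C hA hB, solitonRatio]
  congr 1 <;> ring

theorem solitonRatio_left_zero (C : ℝ) {B D : ℝ} (hB : 0 < B) (hD : 0 < D) :
    solitonRatio C 0 B D = 1 - (1 - C) / (1 + Real.cosh (Real.log (D / B))) := by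
  rw [← sechProfile_eq C hB hD, solitonRatio]
  congr 1 <;> ring

/-- asymptotic elasticity of the two-soliton collision of the variant
Blaszak–Szum lattice in the characteristic coordinates `(ζ₁, ζ₂)`: the two-soliton field
`U = T₁ T₋₁ / T₀²` is real-valued, and as `ζ₂ → ∓∞` it converges to the same sech-type
one-soliton profile in `ζ₁`, phase-shifted by `Ω = ln K`. -/
theorem two_soliton_elastic_collision (s c Z2 K Ω : ℝ)
    (hs : s = Real.sin 1) (hc : c = 1 / (2 * s))
    (hZ2 : Z2 = Real.exp (-2) + Real.exp (1 / 2) - 2 * Real.exp (-3 / 4) * Real.cos 2)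
    (hK : K = 1 / (4 * s ^ 2) + 1 / Z2) (hΩ : Ω = Real.log K)
    (T : ℤ → ℝ → ℝ → ℂ)
    (hT : ∀ (σ : ℤ) (ζ1 ζ2 : ℝ), T σ ζ1 ζ2
      = 1 + (K : ℂ) * Complex.exp ((ζ1 : ℂ) + (ζ2 : ℂ) + 4 * Complex.I * (σ : ℂ))
        + (c : ℂ) * Complex.exp ((ζ1 : ℂ) + 2 * Complex.I * (σ : ℂ))
        + (c : ℂ) * Complex.exp ((ζ2 : ℂ) + 2 * Complex.I * (σ : ℂ)))
    (U : ℝ → ℝ → ℂ)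
    (hU : ∀ ζ1 ζ2 : ℝ, U ζ1 ζ2 = T 1 ζ1 ζ2 * T (-1) ζ1 ζ2 / (T 0 ζ1 ζ2) ^ 2) :
    (∀ ζ1 ζ2 : ℝ, (U ζ1 ζ2).im = 0)
    ∧ (∀ ζ1 : ℝ, Filter.Tendsto (fun ζ2 => U ζ1 ζ2) Filter.atBot
        (nhds (((1 - (1 - Real.cos 2)
          / (1 + Real.cosh (ζ1 - Real.log (2 * s))) : ℝ) : ℂ))))
    ∧ (∀ ζ1 : ℝ, Filter.Tendsto (fun ζ2 => U ζ1 ζ2) Filter.atTop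
        (nhds (((1 - (1 - Real.cos 2)
          / (1 + Real.cosh (ζ1 + Real.log (2 * s) + Ω)) : ℝ) : ℂ)))) := by
  have hs0 : 0 < s := hs ▸ Real.sin_pos_of_pos_of_lt_pi one_pos (by linarith [Real.pi_gt_three])
  have hc0 : 0 < c := by rw [hc]; positivity
  have hZ0 : 0 < Z2 := by
    have hcos : Real.cos 2 < 0 :=
      Real.cos_neg_of_pi_div_two_lt_of_lt (by linarith [Real.pi_lt_four])
        (by linarith [Real.pi_gt_three])
    have := mul_neg_of_pos_of_neg (Real.exp_pos (-3 / 4)) hcos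
    rw [hZ2]
    linarith [Real.exp_pos (-2), Real.exp_pos (1 / 2)]
  have hK0 : 0 < K := by rw [hK]; positivity
  have hU' : ∀ ζ1 ζ2 : ℝ, U ζ1 ζ2 = (solitonRatio (Real.cos 2) 1
      (c * (Real.exp ζ1 + Real.exp ζ2)) (K * (Real.exp ζ1 * Real.exp ζ2)) : ℂ) := by
    intro ζ1 ζ2
    have hwv : Complex.exp (2 * Complex.I) * Complex.exp (-(2 * Complex.I)) = 1 := by
      rw [← Complex.exp_add, add_neg_cancel, Complex.exp_zero]
    have hC : Complex.exp (2 * Complex.I) + Complex.exp (-(2 * Complex.I))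
        = 2 * ((Real.cos 2 : ℝ) : ℂ) := by
      rw [Complex.ofReal_cos, Complex.two_cos, neg_mul]
      norm_num
    have hfour : 4 * Complex.I = 2 * Complex.I + 2 * Complex.I := by ring
    rw [← solitonRatio_eq_complex hwv hC, hU, hT, hT, hT, hfour]
    push_cast
    simp only [mul_one, mul_neg, neg_add, mul_zero, add_zero, Complex.exp_add]
    congr 1 <;> ring
  refine ⟨fun ζ1 ζ2 => by rw [hU', Complex.ofReal_im], fun ζ1 => ?_, fun ζ1 => ?_⟩
  · have hlog : Real.log (c * Real.exp ζ1 / 1) = ζ1 - Real.log (2 * s) := by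
      rw [div_one, Real.log_mul hc0.ne' (Real.exp_ne_zero _), Real.log_exp, hc, one_div,
        Real.log_inv]
      ring
    have hB : 0 < c * Real.exp ζ1 := mul_pos hc0 (Real.exp_pos _)
    rw [← hlog, ← solitonRatio_right_zero _ one_pos hB]
    simp only [hU']
    refine (Complex.continuous_ofReal.tendsto _).comp
      (tendsto_solitonRatio _ tendsto_const_nhds ?_ ?_ (by positivity))
    · simpa using (Real.tendsto_exp_atBot.const_add (Real.exp ζ1)).const_mul c
    · simpa using (Real.tendsto_exp_atBot.const_mul (Real.exp ζ1)).const_mul K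
  · have hD : 0 < K * Real.exp ζ1 := mul_pos hK0 (Real.exp_pos _)
    have hlog : Real.log (K * Real.exp ζ1 / c) = ζ1 + Real.log (2 * s) + Ω := by
      rw [Real.log_div hD.ne' hc0.ne', Real.log_mul hK0.ne' (Real.exp_ne_zero _), Real.log_exp,
        hc, one_div, Real.log_inv, hΩ]
      ring
    rw [← hlog, ← solitonRatio_left_zero _ hc0 hD]
    simp only [hU', fun ζ2 : ℝ => (solitonRatio_smul (Real.cos 2) 1
      (c * (Real.exp ζ1 + Real.exp ζ2)) (K * (Real.exp ζ1 * Real.exp ζ2))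
      (Real.exp_ne_zero (-ζ2))).symm]
    have hexp : ∀ ζ2 : ℝ, Real.exp (-ζ2) * Real.exp ζ2 = 1 := fun ζ2 => by
      rw [← Real.exp_add, neg_add_cancel, Real.exp_zero]
    have hz := Real.tendsto_exp_neg_atTop_nhds_zero
    refine (Complex.continuous_ofReal.tendsto _).comp
      (tendsto_solitonRatio _ (by simpa using hz) ?_ ?_ (by positivity))
    · have hlim := ((hz.mul_const (Real.exp ζ1)).add_const 1).const_mul c
      rw [zero_mul, zero_add, mul_one] at hlim
      refine hlim.congr fun ζ2 => ?_
      linear_combination -c * hexp ζ2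
    · refine tendsto_const_nhds.congr fun ζ2 => ?_
      linear_combination -K * Real.exp ζ1 * hexp ζ2
end

section
/- Let λ, μ, γ, ω ∈ ℂ with λ ≠ 0, and let τ, σ : ℂ⁴ → ℂ be entire and nowhere zero. Suppose τ satisfies (E1) and (E2) of the variant bilinear Blaszak–Szum system, and that τ and σ satisfy, for all (n,t,y,z) ∈ ℂ⁴, the three Bäcklund-transformation relations: (BT1) i(τ_t(n)σ(n) − τ(n)σ_t(n)) + λ^{−1} τ(n−i)σ(n+i) + μ τ(n)σ(n) = 0; (BT2) i(τ_z(n)σ(n+i) − τ(n)σ_z(n+i)) − i(τ_y(n)σ(n+i) − τ(n)σ_y(n+i)) − λ τ(n+i)σ(n) + γ τ(n)σ(n+i) = 0; (BT3) i(τ_z(n)σ(n) − τ(n)σ_z(n)) − i λ^{−1}(τ_t(n−i)σ(n+i) − τ(n−i)σ_t(n+i)) − λ^{−1} μ τ(n−i)σ(n+i) − ω τ(n)σ(n) = 0. Then σ also satisfies (E1) and (E2). -/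
open Metric Set MeasureTheory Function in
/-- Differentiation of the Cauchy formula for a partial derivative with respect to a parameter. -/
lemma hasDerivAt_deriv_param {F : ℂ → ℂ → ℂ} (hF : Differentiable ℂ (uncurry F)) (a b : ℂ) :
    HasDerivAt (fun z => deriv (fun w => F w z) a)
      ((2 * Real.pi * Complex.I)⁻¹ *
        ∮ w in C(a, 1), (1 / (w - a) ^ 2) • deriv (F w) b) b := by
  have hFt : ∀ z, Differentiable ℂ (fun w => F w z) := fun z =>
    hF.comp (f := fun w => (w, z)) (by fun_prop)
  have hFz : ∀ w, Differentiable ℂ (F w) := fun w =>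
    hF.comp (f := fun z => (w, z)) (by fun_prop)
  have hcauchy : ∀ z, deriv (fun w => F w z) a = (2 * Real.pi * Complex.I)⁻¹ *
      ∮ w in C(a, 1), (1 / (w - a) ^ 2) • F w z := fun z => by
    rw [(hFt z).differentiableOn.deriv_eq_smul_circleIntegral one_pos, smul_eq_mul,
      inv_mul_cancel_left₀ Complex.two_pi_I_ne_zero]
  simp_rw [hcauchy]
  refine HasDerivAt.const_mul _ ?_
  set k : ℝ → ℂ := fun θ => deriv (circleMap a 1) θ * (1 / (circleMap a 1 θ - a) ^ 2) with hk
  have hkc : Continuous k := by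
    have hne : ∀ θ, (circleMap a 1 θ - a) ^ 2 ≠ 0 := fun θ =>
      pow_ne_zero _ (sub_ne_zero.2 (circleMap_ne_center one_ne_zero))
    simp only [hk, deriv_circleMap]
    fun_prop (disch := exact hne _)
  have hkn : ∀ θ, ‖k θ‖ = 1 := fun θ => by simp [hk]
  obtain ⟨M, hM⟩ := ((isCompact_closedBall a 1).prod
    (isCompact_closedBall b 2)).exists_bound_of_continuousOn
    hF.continuous.continuousOn
  have hint : ∀ G : ℂ → ℂ, (∮ w in C(a, 1), (1 / (w - a) ^ 2) • G w) =
      ∫ θ in (0 : ℝ)..2 * Real.pi, k θ * G (circleMap a 1 θ) := fun G => by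
    simp [circleIntegral, hk, mul_assoc]
  simp_rw [hint]
  have hcont : ∀ z, Continuous fun θ => k θ * F (circleMap a 1 θ) z := fun z =>
    hkc.mul ((hFt z).continuous.comp (continuous_circleMap a 1))
  refine (intervalIntegral.hasDerivAt_integral_of_dominated_loc_of_deriv_le
    (F' := fun z θ => k θ * deriv (F (circleMap a 1 θ)) z) (bound := fun _ => M)
    (ball_mem_nhds b one_pos) (.of_forall fun z => (hcont z).aestronglyMeasurable)
    ((hcont b).intervalIntegrable _ _) ?_ ?_ intervalIntegrable_const ?_).2
  · have hm : Measurable fun w => deriv (F w) b :=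
      (measurable_deriv_with_param hF.continuous).comp (measurable_id.prodMk measurable_const)
    exact (hkc.measurable.mul
      (hm.comp (continuous_circleMap a 1).measurable)).aestronglyMeasurable
  · refine .of_forall fun θ _ z hz => ?_
    rw [norm_mul, hkn, one_mul, ← div_one M]
    refine Complex.norm_deriv_le_of_forall_mem_sphere_norm_le one_pos (hFz _).diffContOnCl
      fun x hx => hM (circleMap a 1 θ, x) ⟨circleMap_mem_closedBall a zero_le_one θ, ?_⟩
    have := dist_triangle x z b
    rw [mem_sphere] at hx
    rw [mem_ball] at hz
    rw [mem_closedBall]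
    linarith
  · exact .of_forall fun θ _ z _ => ((hFz _ z).hasDerivAt).const_mul _

open Function in
/-- Mixed partial derivatives of a holomorphic function of two variables commute. -/
lemma hasDerivAt_deriv_comm {F : ℂ → ℂ → ℂ} (hF : Differentiable ℂ (uncurry F)) (a b : ℂ) :
    HasDerivAt (fun z => deriv (fun w => F w z) a) (deriv (fun w => deriv (F w) b) a) b := by
  have hswap : Differentiable ℂ (uncurry fun z w => F w z) :=
    hF.comp (f := fun p : ℂ × ℂ => (p.2, p.1)) (by fun_prop)
  have hd : Differentiable ℂ fun w => deriv (F w) b := fun w =>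
    (hasDerivAt_deriv_param hswap b w).differentiableAt
  have h := hasDerivAt_deriv_param hF a b
  rwa [hd.differentiableOn.deriv_eq_smul_circleIntegral one_pos, smul_eq_mul,
    inv_mul_cancel_left₀ Complex.two_pi_I_ne_zero] at h

namespace Entire4

variable {f : ℂ → ℂ → ℂ → ℂ → ℂ}

lemma hasDerivAt_dT (hf : Entire4 f) (n t y z : ℂ) :
    HasDerivAt (fun s => f n s y z) (dT f n t y z) t :=
  (Differentiable.comp (f := fun s => (n, s, y, z)) hf (by fun_prop) t).hasDerivAt

lemma hasDerivAt_dY (hf : Entire4 f) (n t y z : ℂ) :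
    HasDerivAt (fun s => f n t s z) (dY f n t y z) y :=
  (Differentiable.comp (f := fun s => (n, t, s, z)) hf (by fun_prop) y).hasDerivAt

lemma hasDerivAt_dZ (hf : Entire4 f) (n t y z : ℂ) :
    HasDerivAt (fun s => f n t y s) (dZ f n t y z) z :=
  (Differentiable.comp (f := fun s => (n, t, y, s)) hf (by fun_prop) z).hasDerivAt

lemma hasDerivAt_dT_dT (hf : Entire4 f) (n t y z : ℂ) :
    HasDerivAt (fun s => dT f n s y z) (dT (dT f) n t y z) t :=
  (Differentiable.deriv (f := fun s => f n s y z)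
    (fun s => (hf.hasDerivAt_dT n s y z).differentiableAt) t).hasDerivAt

lemma hasDerivAt_dT_dY (hf : Entire4 f) (n t y z : ℂ) :
    HasDerivAt (fun s => dT f n t s z) (dT (dY f) n t y z) y :=
  hasDerivAt_deriv_comm (F := fun w s => f n w s z)
    (Differentiable.comp (f := fun p : ℂ × ℂ => (n, p.1, p.2, z)) hf (by fun_prop)) t y

lemma hasDerivAt_dT_dZ (hf : Entire4 f) (n t y z : ℂ) :
    HasDerivAt (fun s => dT f n t y s) (dT (dZ f) n t y z) z :=
  hasDerivAt_deriv_comm (F := fun w s => f n w y s)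
    (Differentiable.comp (f := fun p : ℂ × ℂ => (n, p.1, y, p.2)) hf (by fun_prop)) t z

end Entire4

/-- The derivative of the relation
`c (f' g - f g') + l h k + m f g = 0` along a one-parameter family. -/
lemma deriv_bilinear_relation {f f' g g' h k : ℂ → ℂ} {c l m x df df' dg dg' dh dk : ℂ}
    (hf : HasDerivAt f df x) (hf' : HasDerivAt f' df' x)
    (hg : HasDerivAt g dg x) (hg' : HasDerivAt g' dg' x)
    (hh : HasDerivAt h dh x) (hk : HasDerivAt k dk x)
    (hrel : ∀ s, c * (f' s * g s - f s * g' s) + l * h s * k s + m * f s * g s = 0) :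
    c * (df' * g x + f' x * dg - df * g' x - f x * dg')
      + l * (dh * k x + h x * dk) + m * (df * g x + f x * dg) = 0 := by
  have hd := ((((hf'.mul hg).sub (hf.mul hg')).const_mul c).add
    ((hh.const_mul l).mul hk)).add ((hf.const_mul m).mul hg)
  have hzero := hd.unique ((hasDerivAt_const x (0 : ℂ)).congr_of_eventuallyEq
    (.of_forall fun s => hrel s))
  linear_combination hzero

section Algebra

variable {K : Type*} [Field K] {i lam μ γ ω : K}

/-- The algebraic core of the first equation: the suffix is the shift in `n`
(`m` for `-i`, `0`, `1`, `2` for multiples of `i`), `t`, `tt`, `z` are derivatives. -/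
lemma bilinear_first_of_backlund (hi : i ^ 2 = -1)
    {Tm T0 T1 S0 S1 S2 Tmt T0t T1t S0t S1t S2t T0tt T1tt S0tt S1tt T0z T1z S0z S1z : K}
    (hT0 : T0 ≠ 0) (hT1 : T1 ≠ 0) (hS0 : S0 ≠ 0) (hS1 : S1 ≠ 0)
    (hE : -i * (T1z * T0 - T1 * T0z) = T1tt * T0 - 2 * T1t * T0t + T1 * T0tt)
    (hA0 : i * (T0t * S0 - T0 * S0t) + lam⁻¹ * Tm * S1 + μ * T0 * S0 = 0)
    (hA1 : i * (T1t * S1 - T1 * S1t) + lam⁻¹ * T0 * S2 + μ * T1 * S1 = 0)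
    (hA0t : i * (T0tt * S0 - T0 * S0tt)
      + lam⁻¹ * (Tmt * S1 + Tm * S1t) + μ * (T0t * S0 + T0 * S0t) = 0)
    (hA1t : i * (T1tt * S1 - T1 * S1tt)
      + lam⁻¹ * (T0t * S2 + T0 * S2t) + μ * (T1t * S1 + T1 * S1t) = 0)
    (hZ0 : i * (T0z * S0 - T0 * S0z) - i * lam⁻¹ * (Tmt * S1 - Tm * S1t)
      - lam⁻¹ * μ * Tm * S1 - ω * T0 * S0 = 0)
    (hZ1 : i * (T1z * S1 - T1 * S1z) - i * lam⁻¹ * (T0t * S2 - T0 * S2t)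
      - lam⁻¹ * μ * T0 * S2 - ω * T1 * S1 = 0) :
    -i * (S1z * S0 - S1 * S0z) = S1tt * S0 - 2 * S1t * S0t + S1 * S0tt := by
  generalize lam⁻¹ = l at *
  have key : (-i * (S1z * S0 - S1 * S0z)
      - (S1tt * S0 - 2 * S1t * S0t + S1 * S0tt)) / (S1 * S0) = 0 := by
    linear_combination (norm := (field_simp; ring))
      hE / (T1 * T0) + hZ1 / (T1 * S1) - hZ0 / (T0 * S0)
      - i * (hA1t / (T1 * S1) - hA1 / (T1 * S1) * (T1t / T1 + S1t / S1))
      - i * (hA0t / (T0 * S0) - hA0 / (T0 * S0) * (T0t / T0 + S0t / S0))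
      - i * (T1t / T1 - T0t / T0 + S1t / S1 - S0t / S0)
        * (hA1 / (T1 * S1) - hA0 / (T0 * S0))
      - l * (Tm * S1 / (T0 * S0) * hA1 / (T1 * S1)
        - T0 * S2 / (T1 * S1) * hA0 / (T0 * S0))
      + hi * ((T1tt / T1 - (T1t / T1) ^ 2 - S1tt / S1 + (S1t / S1) ^ 2)
        + (T0tt / T0 - (T0t / T0) ^ 2 - S0tt / S0 + (S0t / S0) ^ 2)
        + (T1t / T1 - T0t / T0 + S1t / S1 - S0t / S0)
          * (T1t / T1 - S1t / S1 - T0t / T0 + S0t / S0))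
  rw [div_eq_zero_iff] at key
  exact sub_eq_zero.1 (key.resolve_right (mul_ne_zero hS1 hS0))

/-- The algebraic core of the second equation: the suffix is the shift in `n`
(`m` for `-i`, `0`, `1` for multiples of `i`), `t` is a derivative and `d` stands for the
difference of the `z` and `y` derivatives. -/
lemma bilinear_second_of_backlund (hi : i ^ 2 = -1) (hlam : lam ≠ 0)
    {Tm T0 T1 Sm S0 S1 T0t S0t Tmd T0d S0d S1d T0td S0td : K} (hT0 : T0 ≠ 0)
    (hE : T0td * T0 - T0t * T0d = T0 ^ 2 - T1 * Tm)
    (hA : i * (T0t * S0 - T0 * S0t) + lam⁻¹ * Tm * S1 + μ * T0 * S0 = 0)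
    (hAd : i * (T0td * S0 + T0t * S0d - T0d * S0t - T0 * S0td)
      + lam⁻¹ * (Tmd * S1 + Tm * S1d) + μ * (T0d * S0 + T0 * S0d) = 0)
    (hC0 : i * (T0d * S1 - T0 * S1d) - lam * T1 * S0 + γ * T0 * S1 = 0)
    (hCm : i * (Tmd * S0 - Tm * S0d) - lam * T0 * Sm + γ * Tm * S0 = 0) :
    S0td * S0 - S0t * S0d = S0 ^ 2 - S1 * Sm := by
  have hl : lam⁻¹ * lam = 1 := inv_mul_cancel₀ hlam
  generalize lam⁻¹ = l at *
  refine sub_eq_zero.1 ((mul_eq_zero.1 ?_).resolve_left (pow_ne_zero 2 hT0))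
  linear_combination i * (T0 * S0 * hAd - (T0d * S0 + T0 * S0d) * hA) + S0 ^ 2 * hE
    - l * (T0 * S1 * hCm - S0 * Tm * hC0)
    - (T0 ^ 2 * S1 * Sm - S0 ^ 2 * Tm * T1) * hl
    - hi * (S0 ^ 2 * (T0td * T0 - T0t * T0d) - T0 ^ 2 * (S0td * S0 - S0t * S0d))

end Algebra

/-- the Bäcklund transformation of the variant bilinear Blaszak–Szum system:
if the entire nowhere-zero functions `τ`, `σ` satisfy (BT1)–(BT3) and `τ` solves the system,
then so does `σ`. -/
theorem backlund_transformation_variantBS (lam μ γ ω : ℂ) (hlam : lam ≠ 0)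
    (τ σ : ℂ → ℂ → ℂ → ℂ → ℂ) (hτe : Entire4 τ) (hσe : Entire4 σ)
    (hτ0 : ∀ n t y z, τ n t y z ≠ 0) (hσ0 : ∀ n t y z, σ n t y z ≠ 0)
    (hτBS : VariantBS τ)
    (hBT1 : ∀ n t y z : ℂ,
      Complex.I * (dT τ n t y z * σ n t y z - τ n t y z * dT σ n t y z)
        + lam⁻¹ * τ (n - Complex.I) t y z * σ (n + Complex.I) t y z
        + μ * τ n t y z * σ n t y z = 0)
    (hBT2 : ∀ n t y z : ℂ,
      Complex.I * (dZ τ n t y z * σ (n + Complex.I) t y z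
          - τ n t y z * dZ σ (n + Complex.I) t y z)
        - Complex.I * (dY τ n t y z * σ (n + Complex.I) t y z
          - τ n t y z * dY σ (n + Complex.I) t y z)
        - lam * τ (n + Complex.I) t y z * σ n t y z
        + γ * τ n t y z * σ (n + Complex.I) t y z = 0)
    (hBT3 : ∀ n t y z : ℂ,
      Complex.I * (dZ τ n t y z * σ n t y z - τ n t y z * dZ σ n t y z)
        - Complex.I * lam⁻¹ * (dT τ (n - Complex.I) t y z * σ (n + Complex.I) t y z
          - τ (n - Complex.I) t y z * dT σ (n + Complex.I) t y z)
        - lam⁻¹ * μ * τ (n - Complex.I) t y z * σ (n + Complex.I) t y z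
        - ω * τ n t y z * σ n t y z = 0) :
    VariantBS σ := by
  intro n t y z
  have hA1 := hBT1 (n + Complex.I) t y z
  have hZ1 := hBT3 (n + Complex.I) t y z
  have hCm := hBT2 (n - Complex.I) t y z
  have hAt := fun n => deriv_bilinear_relation (hτe.hasDerivAt_dT n t y z)
    (hτe.hasDerivAt_dT_dT n t y z) (hσe.hasDerivAt_dT n t y z) (hσe.hasDerivAt_dT_dT n t y z)
    (hτe.hasDerivAt_dT (n - Complex.I) t y z) (hσe.hasDerivAt_dT (n + Complex.I) t y z)
    (fun s => hBT1 n s y z)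
  have hAy := deriv_bilinear_relation (hτe.hasDerivAt_dY n t y z)
    (hτe.hasDerivAt_dT_dY n t y z) (hσe.hasDerivAt_dY n t y z) (hσe.hasDerivAt_dT_dY n t y z)
    (hτe.hasDerivAt_dY (n - Complex.I) t y z) (hσe.hasDerivAt_dY (n + Complex.I) t y z)
    (fun s => hBT1 n t s z)
  have hAz := deriv_bilinear_relation (hτe.hasDerivAt_dZ n t y z)
    (hτe.hasDerivAt_dT_dZ n t y z) (hσe.hasDerivAt_dZ n t y z) (hσe.hasDerivAt_dT_dZ n t y z)
    (hτe.hasDerivAt_dZ (n - Complex.I) t y z) (hσe.hasDerivAt_dZ (n + Complex.I) t y z)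
    (fun s => hBT1 n t y s)
  have hA0t := hAt n
  have hA1t := hAt (n + Complex.I)
  simp only [add_sub_cancel_right] at hA1 hZ1 hA0t hA1t
  rw [sub_add_cancel] at hCm
  obtain ⟨hE1, hE2⟩ := hτBS n t y z
  refine ⟨bilinear_first_of_backlund Complex.I_sq (hτ0 n t y z) (hτ0 (n + Complex.I) t y z)
    (hσ0 n t y z) (hσ0 (n + Complex.I) t y z) hE1 (hBT1 n t y z) hA1 hA0t hA1t
    (hBT3 n t y z) hZ1, ?_⟩
  refine bilinear_second_of_backlund (γ := γ) (μ := μ) Complex.I_sq hlam (hτ0 n t y z) hE2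
    (hBT1 n t y z) (Tmd := dZ τ (n - Complex.I) t y z - dY τ (n - Complex.I) t y z)
    (S1d := dZ σ (n + Complex.I) t y z - dY σ (n + Complex.I) t y z) ?_ ?_ ?_
  · linear_combination hAz - hAy
  · linear_combination hBT2 n t y z
  · linear_combination hCm
end

section
/- Let λ₁, λ₂ ∈ ℂ \ {0} with λ₁ ≠ λ₂, and let β₁, β₂ ∈ ℂ. Define the entire functions θ_j(n,t,y,z) = n + λ_j^{−1} t + (2λ_j^{−2} − λ_j) y + 2λ_j^{−2} z + β_j for j = 1,2. Then the quadratic polynomial tau function τ(n,t,y,z) = θ₁(n,t,y,z)·θ₂(n,t,y,z) − λ₁λ₂/(λ₁ − λ₂)² satisfies both equations (E1) and (E2) of the variant bilinear Blaszak–Szum system. -/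
/-- The affine phase with coefficients `a`, `b`, `c` in `t`, `y`, `z` and constant term `β`. -/
def affinePhase (a b c β n t y z : ℂ) : ℂ := n + a * t + b * y + c * z + β

section Derivatives

variable (a b c β a₂ b₂ c₂ β₂ k : ℂ)

theorem affinePhase_shift (n w t y z : ℂ) :
    affinePhase a b c β (n + w) t y z = affinePhase a b c β n t y z + w := by
  unfold affinePhase
  ring

theorem hasDerivAt_affinePhase_t (n t y z : ℂ) :
    HasDerivAt (fun s => affinePhase a b c β n s y z) a t := by
  simpa [affinePhase] using
    (((((hasDerivAt_id t).const_mul a).const_add n).add_const (b * y)).add_const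
      (c * z)).add_const β

theorem hasDerivAt_affinePhase_y (n t y z : ℂ) :
    HasDerivAt (fun s => affinePhase a b c β n t s z) b y := by
  simpa [affinePhase] using
    ((((hasDerivAt_id y).const_mul b).const_add (n + a * t)).add_const (c * z)).add_const β

theorem hasDerivAt_affinePhase_z (n t y z : ℂ) :
    HasDerivAt (fun s => affinePhase a b c β n t y s) c z := by
  simpa [affinePhase] using
    (((hasDerivAt_id z).const_mul c).const_add (n + a * t + b * y)).add_const β

theorem dT_affinePhase_mul_sub_const :
    dT (fun n t y z => affinePhase a b c β n t y z * affinePhase a₂ b₂ c₂ β₂ n t y z - k) =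
      fun n t y z => a * affinePhase a₂ b₂ c₂ β₂ n t y z + affinePhase a b c β n t y z * a₂ := by
  funext n t y z
  exact (((hasDerivAt_affinePhase_t a b c β n t y z).mul
    (hasDerivAt_affinePhase_t a₂ b₂ c₂ β₂ n t y z)).sub_const k).deriv

theorem dY_affinePhase_mul_sub_const :
    dY (fun n t y z => affinePhase a b c β n t y z * affinePhase a₂ b₂ c₂ β₂ n t y z - k) =
      fun n t y z => b * affinePhase a₂ b₂ c₂ β₂ n t y z + affinePhase a b c β n t y z * b₂ := by
  funext n t y z
  exact (((hasDerivAt_affinePhase_y a b c β n t y z).mul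
    (hasDerivAt_affinePhase_y a₂ b₂ c₂ β₂ n t y z)).sub_const k).deriv

theorem dZ_affinePhase_mul_sub_const :
    dZ (fun n t y z => affinePhase a b c β n t y z * affinePhase a₂ b₂ c₂ β₂ n t y z - k) =
      fun n t y z => c * affinePhase a₂ b₂ c₂ β₂ n t y z + affinePhase a b c β n t y z * c₂ := by
  funext n t y z
  exact (((hasDerivAt_affinePhase_z a b c β n t y z).mul
    (hasDerivAt_affinePhase_z a₂ b₂ c₂ β₂ n t y z)).sub_const k).deriv

theorem dT_affinePhase_linear_combination (u v : ℂ) :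
    dT (fun n t y z => u * affinePhase a₂ b₂ c₂ β₂ n t y z + affinePhase a b c β n t y z * v) =
      fun _ _ _ _ => u * a₂ + a * v := by
  funext n t y z
  exact (((hasDerivAt_affinePhase_t a₂ b₂ c₂ β₂ n t y z).const_mul u).add
    ((hasDerivAt_affinePhase_t a b c β n t y z).mul_const v)).deriv

end Derivatives

/-- the one-lump quadratic tau function
`τ = θ₁θ₂ − λ₁λ₂/(λ₁−λ₂)²` solves the variant bilinear Blaszak–Szum system. -/
theorem one_lump_tau_solves_variantBS (lam1 lam2 : ℂ) (h1 : lam1 ≠ 0) (h2 : lam2 ≠ 0)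
    (h12 : lam1 ≠ lam2) (β1 β2 : ℂ) :
    VariantBS (fun n t y z =>
      (n + lam1⁻¹ * t + (2 / lam1 ^ 2 - lam1) * y + 2 / lam1 ^ 2 * z + β1)
        * (n + lam2⁻¹ * t + (2 / lam2 ^ 2 - lam2) * y + 2 / lam2 ^ 2 * z + β2)
      - lam1 * lam2 / (lam1 - lam2) ^ 2) := by
  set k := lam1 * lam2 / (lam1 - lam2) ^ 2 with hk
  have hsub : lam1 - lam2 ≠ 0 := sub_ne_zero.mpr h12
  have hk_inv : (lam1⁻¹ - lam2⁻¹) ^ 2 * k = lam1⁻¹ * lam2⁻¹ := by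
    rw [hk]
    field_simp
    ring
  have hk_ratio : k * (lam1 * lam2⁻¹ + lam2 * lam1⁻¹ - 2) = 1 := by
    rw [hk]
    field_simp
    ring
  have hlam1 : lam1 * lam1⁻¹ = 1 := mul_inv_cancel₀ h1
  have hlam2 : lam2 * lam2⁻¹ = 1 := mul_inv_cancel₀ h2
  change VariantBS (fun n t y z =>
    affinePhase lam1⁻¹ (2 / lam1 ^ 2 - lam1) (2 / lam1 ^ 2) β1 n t y z
      * affinePhase lam2⁻¹ (2 / lam2 ^ 2 - lam2) (2 / lam2 ^ 2) β2 n t y z - k)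
  intro n t y z
  simp only [dT_affinePhase_mul_sub_const, dY_affinePhase_mul_sub_const,
    dZ_affinePhase_mul_sub_const, dT_affinePhase_linear_combination, sub_eq_add_neg n,
    affinePhase_shift]
  generalize affinePhase lam1⁻¹ (2 / lam1 ^ 2 - lam1) (2 / lam1 ^ 2) β1 n t y z = P
  generalize affinePhase lam2⁻¹ (2 / lam2 ^ 2 - lam2) (2 / lam2 ^ 2) β2 n t y z = Q
  simp only [div_eq_mul_inv, ← inv_pow]
  clear_value k
  generalize lam1⁻¹ = a at *
  generalize lam2⁻¹ = b at *
  have hI : Complex.I ^ 2 = -1 := Complex.I_sq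
  generalize Complex.I = w at *
  constructor
  · linear_combination (-2) * hk_inv
      + (-2 * (a ^ 2 + b ^ 2) * (P * Q - k) + (P + Q + w) * (2 * a ^ 2 * Q + 2 * b ^ 2 * P)
        - 2 * a * b) * hI
  · linear_combination (-1) * hk_ratio - Q ^ 2 * hlam1 - P ^ 2 * hlam2
      + (2 * (P * Q - k) - (P + Q) ^ 2 + w ^ 2 - 1) * hI
end

section
/- Let a, b ∈ ℝ with b ≠ 0, and set C = (a² + b²)/(4b²). For R, I ∈ ℝ define F(s) = (R + iI + s·i)(R − iI + s·i) + C for s ∈ {−1, 0, 1}. Then F(0) = R² + I² + C > 0 and F(1)·F(−1)/F(0)² = 1 + 2(R² − I² + (b² − a²)/(4b²)) / (R² + I² + (a² + b²)/(4b²))². In particular the one-lump solution u(n) = τ₁₂(n+i)τ₁₂(n−i)/τ₁₂(n)² of the variant Blaszak–Szum lattice equals 1 + 2(𝓡² − 𝓘² + (b²−a²)/(4b²))/(𝓡² + 𝓘² + (a²+b²)/(4b²))², where 𝓡 and 𝓘 are the real and imaginary parts of θ₁. -/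
/-- the one-lump profile of the variant Blaszak–Szum lattice: with
`F(s) = (𝓡 + i𝓘 + si)(𝓡 − i𝓘 + si) + C`, `C = (a² + b²)/(4b²)`, one has
`F(0) = 𝓡² + 𝓘² + C > 0` and the explicit rational formula for `F(1)F(−1)/F(0)²`. -/
theorem one_lump_profile (a b : ℝ) (hb : b ≠ 0) (R I : ℝ) (C : ℝ)
    (hC : C = (a ^ 2 + b ^ 2) / (4 * b ^ 2)) (F : ℂ → ℂ)
    (hF : ∀ s : ℂ, F s = ((R : ℂ) + Complex.I * (I : ℂ) + s * Complex.I)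
        * ((R : ℂ) - Complex.I * (I : ℂ) + s * Complex.I) + (C : ℂ)) :
    F 0 = ((R ^ 2 + I ^ 2 + C : ℝ) : ℂ)
    ∧ 0 < R ^ 2 + I ^ 2 + C
    ∧ F 1 * F (-1) / (F 0) ^ 2
      = ((1 + 2 * (R ^ 2 - I ^ 2 + (b ^ 2 - a ^ 2) / (4 * b ^ 2))
            / (R ^ 2 + I ^ 2 + (a ^ 2 + b ^ 2) / (4 * b ^ 2)) ^ 2 : ℝ) : ℂ) := by
  have hpos : 0 < R ^ 2 + I ^ 2 + C := by
    rw [hC]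
    positivity
  have hF_zero : F 0 = ((R ^ 2 + I ^ 2 + C : ℝ) : ℂ) := by
    rw [hF]
    push_cast
    linear_combination -(I : ℂ) ^ 2 * Complex.I_sq
  have hF_mul : F 1 * F (-1) = (((R ^ 2 + I ^ 2 + C - 1) ^ 2 + 4 * R ^ 2 : ℝ) : ℂ) := by
    have hF_one : F 1 = (R : ℂ) ^ 2 + I ^ 2 + C - 1 + 2 * R * Complex.I := by
      rw [hF]
      linear_combination (1 - (I : ℂ) ^ 2) * Complex.I_sq
    have hF_neg_one : F (-1) = (R : ℂ) ^ 2 + I ^ 2 + C - 1 - 2 * R * Complex.I := by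
      rw [hF]
      linear_combination (1 - (I : ℂ) ^ 2) * Complex.I_sq
    rw [hF_one, hF_neg_one]
    push_cast
    linear_combination -4 * (R : ℂ) ^ 2 * Complex.I_sq
  have hC_compl : (b ^ 2 - a ^ 2) / (4 * b ^ 2) = 1 / 2 - C := by
    rw [hC]
    field_simp
    ring
  refine ⟨hF_zero, hpos, ?_⟩
  rw [hF_mul, hF_zero, ← hC, hC_compl]
  norm_cast
  have hne := hpos.ne'
  field_simp
  ring
end

section
/- Let N ≥ 1, let λ₁, …, λ_N ∈ ℂ \ {0}, and let β₁, …, β_N ∈ ℂ. Define τ_k(n,t,y,z) = n + λ_k^{−1} t + (2λ_k^{−2} − λ_k) y + 2λ_k^{−2} z + β_k. Then the N×N determinant τ(n,t,y,z) = det_{1≤j,k≤N}( (−λ_k)^{j−1} · τ_k(n − (j−1)i, t, y, z) ) satisfies both equations (E1) and (E2) of the variant bilinear Blaszak–Szum system. -/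
open Function Matrix

/-- Replacing each row in turn and summing the determinants, expanded by the Leibniz formula. -/
lemma sum_det_updateRow {ι R : Type*} [Fintype ι] [DecidableEq ι] [CommRing R]
    (M W : Matrix ι ι R) :
    ∑ a, (M.updateRow a (W a)).det = ∑ σ : Equiv.Perm ι, ((Equiv.Perm.sign σ : ℤ) : R) *
      ∑ i, (∏ j ∈ Finset.univ.erase i, M (σ j) j) * W (σ i) i := by
  simp_rw [det_apply']
  rw [Finset.sum_comm]
  refine Finset.sum_congr rfl fun σ _ => ?_
  rw [← Finset.mul_sum, ← Equiv.sum_comp σ]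
  congr 1
  refine Finset.sum_congr rfl fun i _ => ?_
  rw [← Finset.prod_erase_mul _ _ (Finset.mem_univ i), updateRow_self]
  congr 1
  refine Finset.prod_congr rfl fun j hj => ?_
  rw [updateRow_ne (σ.injective.ne (Finset.ne_of_mem_erase hj))]

/-- Rescaling the columns of one row at a time multiplies the determinant by the trace. -/
lemma sum_det_updateRow_mul {ι R : Type*} [Fintype ι] [DecidableEq ι] [CommRing R]
    (M : Matrix ι ι R) (d : ι → R) :
    ∑ a, (M.updateRow a (fun k => d k * M a k)).det = (∑ k, d k) * M.det := by
  rw [sum_det_updateRow M (fun a k => d k * M a k), det_apply', Finset.mul_sum]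
  refine Finset.sum_congr rfl fun σ _ => ?_
  rw [mul_left_comm, Finset.sum_mul]
  congr 1
  refine Finset.sum_congr rfl fun i _ => ?_
  rw [mul_left_comm, Finset.prod_erase_mul _ (fun j => M (σ j) j) (Finset.mem_univ i)]

lemma hasDerivAt_det_s11 {ι 𝕜 : Type*} [Fintype ι] [DecidableEq ι] [NontriviallyNormedField 𝕜]
    {M : 𝕜 → Matrix ι ι 𝕜} {M' : Matrix ι ι 𝕜} {x : 𝕜}
    (h : ∀ i j, HasDerivAt (fun s => M s i j) (M' i j) x) :
    HasDerivAt (fun s => (M s).det) (∑ a, ((M x).updateRow a (M' a)).det) x := by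
  rw [sum_det_updateRow]
  simp_rw [det_apply']
  refine HasDerivAt.fun_sum fun σ _ => HasDerivAt.const_mul _ ?_
  simpa using HasDerivAt.fun_finsetProd (u := Finset.univ) fun i _ => h (σ i) i

/-- The determinant whose rows are selected from the sequence `v` by the index vector `J`. -/
def rowDet {ι : Type*} [Fintype ι] [DecidableEq ι] (v : ℤ → ι → ℂ) (J : ι → ℤ) : ℂ :=
  (Matrix.of fun a k => v (J a) k).det

section rowDet

variable {ι : Type*} [Fintype ι] [DecidableEq ι]

lemma rowDet_update (v : ℤ → ι → ℂ) (J : ι → ℤ) (a : ι) (x : ℤ) :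
    rowDet v (update J a x) = ((Matrix.of fun a k => v (J a) k).updateRow a (v x)).det := by
  unfold rowDet
  congr 1
  ext b k
  by_cases hb : b = a
  · subst hb; simp
  · simp [hb]

lemma rowDet_eq_zero (v : ℤ → ι → ℂ) {J : ι → ℤ} {a b : ι} (hab : a ≠ b) (h : J a = J b) :
    rowDet v J = 0 :=
  det_zero_of_row_eq hab (by ext k; simp [h])

lemma rowDet_comp_perm (v : ℤ → ι → ℂ) (J : ι → ℤ) (σ : Equiv.Perm ι) :
    rowDet v (J ∘ σ) = ((Equiv.Perm.sign σ : ℤ) : ℂ) * rowDet v J :=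
  det_permute σ (Matrix.of fun a k => v (J a) k)

/-- Cramer's rule, followed by a linear functional that is itself a determinant. -/
lemma rowDet_mul_rowDet_update (v : ℤ → ι → ℂ) (J K : ι → ℤ) (b : ι) (x : ℤ) :
    rowDet v J * rowDet v (update K b x) =
      ∑ a, rowDet v (update J a x) * rowDet v (update K b (J a)) := by
  have key : ∑ a, rowDet v (update J a x) • v (J a) = rowDet v J • v x := by
    have h := mulVec_cramer (Matrix.of fun a k => v (J a) k)ᵀ (v x)
    rw [det_transpose] at h
    rw [rowDet, ← h]
    ext k
    simp only [Finset.sum_apply, Pi.smul_apply, smul_eq_mul, mulVec, dotProduct,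
      cramer_transpose_apply, rowDet_update, transpose_apply, of_apply]
    exact Finset.sum_congr rfl fun a _ => mul_comm _ _
  let f : (ι → ℂ) →ₗ[ℂ] ℂ :=
    (detRowAlternating : (ι → ℂ) [⋀^ι]→ₗ[ℂ] ℂ).toMultilinearMap.toLinearMap
      (fun a => v (K a)) b
  have hf (y : ℤ) : f (v y) = rowDet v (update K b y) := by rw [rowDet_update]; rfl
  simpa [hf] using (congrArg f key).symm

lemma hasDerivAt_rowDet {v : ℂ → ℤ → ι → ℂ} {x α α' : ℂ} {q q' : ℤ} {d : ι → ℂ}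
    (h : ∀ j k, HasDerivAt (fun s => v s j k)
      (α * v x (j + q) k + α' * v x (j + q') k + d k * v x j k) x) (J : ι → ℤ) :
    HasDerivAt (fun s => rowDet (v s) J)
      (α * ∑ a, rowDet (v x) (update J a (J a + q))
        + α' * ∑ a, rowDet (v x) (update J a (J a + q')) + (∑ k, d k) * rowDet (v x) J) x := by
  have key := hasDerivAt_det_s11 (M := fun s => Matrix.of fun a k => v s (J a) k)
    (M' := Matrix.of fun a => α • v x (J a + q) + α' • v x (J a + q') + fun k => d k * v x (J a) k)
    (x := x) (fun a k => by simpa using h (J a) k)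
  refine key.congr_deriv ?_
  rw [rowDet, ← sum_det_updateRow_mul, Finset.mul_sum, Finset.mul_sum, ← Finset.sum_add_distrib,
    ← Finset.sum_add_distrib]
  refine Finset.sum_congr rfl fun a _ => ?_
  rw [rowDet_update, rowDet_update, ← det_updateRow_smul, ← det_updateRow_smul,
    ← det_updateRow_add, ← det_updateRow_add]
  rfl

end rowDet

section consecutive

variable {m : ℕ}

/-- The index vector `0, 1, …, m + 1`. -/
def stdIndex (m : ℕ) : Fin (m + 2) → ℤ := fun a => (a : ℕ)

/-- The determinant with leading rows `a`, `b`, followed by the rows `1, …, m`. -/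
def pairDet (v : ℤ → Fin (m + 2) → ℂ) (a b : ℤ) : ℂ :=
  rowDet v (Fin.cons a (Fin.cons b fun k : Fin m => (k : ℤ) + 1))

lemma rowDet_snoc {n : ℕ} (v : ℤ → Fin (n + 1) → ℂ) (J : Fin n → ℤ) (x : ℤ) :
    rowDet v (Fin.snoc J x : Fin (n + 1) → ℤ) = (-1) ^ n * rowDet v (Fin.cons x J) := by
  have h := rowDet_comp_perm v (Fin.cons x J : Fin (n + 1) → ℤ) (finRotate (n + 1))
  rw [sign_finRotate] at h
  rw [Fin.snoc_eq_cons_rotate]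
  simpa [Function.comp_def] using h

lemma pairDet_swap (v : ℤ → Fin (m + 2) → ℂ) (a b : ℤ) : pairDet v b a = -pairDet v a b := by
  have h := rowDet_comp_perm v
    (Fin.cons a (Fin.cons b fun k : Fin m => (k : ℤ) + 1)) (Equiv.swap 0 1)
  rw [Equiv.Perm.sign_swap (by simp)] at h
  rw [pairDet, pairDet, ← neg_one_mul]
  convert h using 2
  · funext i
    refine Fin.cases ?_ (fun i => ?_) i
    · rw [Function.comp_apply, Equiv.swap_apply_left, ← Fin.succ_zero_eq_one]; rfl
    refine Fin.cases ?_ (fun i => ?_) i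
    · simp
    · rw [Function.comp_apply, Equiv.swap_apply_of_ne_of_ne (by simp)
        (by simp [Fin.ext_iff])]
      simp
  · simp

/-- The three-term Plücker relation. -/
lemma pairDet_plucker (v : ℤ → Fin (m + 2) → ℂ) (a b c d : ℤ) :
    pairDet v a b * pairDet v c d =
      pairDet v c b * pairDet v a d + pairDet v a c * pairDet v b d := by
  have h := rowDet_mul_rowDet_update v (Fin.cons a (Fin.cons b fun k : Fin m => (k : ℤ) + 1))
    (Fin.cons 0 (Fin.cons d fun k : Fin m => (k : ℤ) + 1)) 0 c
  rw [Fin.sum_univ_succ, Fin.sum_univ_succ, Finset.sum_eq_zero] at h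
  · have hu : update (Fin.cons a (Fin.cons b fun k : Fin m => (k : ℤ) + 1) : Fin (m + 2) → ℤ) 1 c =
        Fin.cons a (Fin.cons c fun k : Fin m => (k : ℤ) + 1) := by
      rw [← Fin.succ_zero_eq_one, ← Fin.cons_update, Fin.update_cons_zero]
    simpa [pairDet, hu, Fin.update_cons_zero] using h
  · intro i _
    rw [rowDet_eq_zero v (J := update _ 0 _) (a := 0) (b := i.succ.succ), mul_zero]
    · exact (Fin.succ_ne_zero _).symm
    · simp

variable (v : ℤ → Fin (m + 2) → ℂ)

lemma rowDet_update_update_stdIndex (a b : ℤ) :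
    rowDet v (update (update (stdIndex m) (Fin.last _) b) 0 a) =
      (-1) ^ (m + 1) * pairDet v b a := by
  rw [pairDet, ← rowDet_snoc, ← Fin.cons_snoc_eq_snoc_cons]
  congr 1
  funext i
  refine Fin.cases ?_ (fun i => ?_) i
  · simp
  refine Fin.lastCases ?_ (fun i => ?_) i
  · simp
  · simp [Fin.ext_iff, stdIndex, i.isLt.ne]

lemma update_last_stdIndex : update (stdIndex m) (Fin.last _) (m + 1 : ℤ) = stdIndex m := by
  rw [update_eq_self_iff]; simp [stdIndex]

lemma update_zero_stdIndex (b : ℤ) :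
    update (update (stdIndex m) (Fin.last _) b) 0 0 = update (stdIndex m) (Fin.last _) b := by
  rw [update_eq_self_iff, update_of_ne (by simp [Fin.ext_iff])]; simp [stdIndex]

lemma rowDet_update_zero_stdIndex (a : ℤ) :
    rowDet v (update (stdIndex m) 0 a) = (-1) ^ (m + 1) * pairDet v (m + 1) a := by
  rw [← rowDet_update_update_stdIndex, update_last_stdIndex]

lemma rowDet_update_last_stdIndex (b : ℤ) :
    rowDet v (update (stdIndex m) (Fin.last _) b) = (-1) ^ (m + 1) * pairDet v b 0 := by
  rw [← rowDet_update_update_stdIndex, update_zero_stdIndex]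

lemma rowDet_stdIndex : rowDet v (stdIndex m) = (-1) ^ (m + 1) * pairDet v (m + 1) 0 := by
  rw [← rowDet_update_last_stdIndex, update_last_stdIndex]

lemma rowDet_stdIndex_sub_one :
    rowDet v (fun a => stdIndex m a - 1) = pairDet v (-1) 0 := by
  rw [pairDet]
  congr 1
  funext i
  refine Fin.cases ?_ (fun i => ?_) i
  · simp [stdIndex]
  refine Fin.cases ?_ (fun i => ?_) i <;> simp [stdIndex]

lemma rowDet_stdIndex_add_one :
    rowDet v (fun a => stdIndex m a + 1) = pairDet v (m + 1) (m + 2) := by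
  have h : (fun a => stdIndex m a + 1) =
      (Fin.snoc (Fin.snoc (fun k : Fin m => (k : ℤ) + 1) (m + 1 : ℤ) : Fin (m + 1) → ℤ)
        (m + 2 : ℤ) : Fin (m + 2) → ℤ) := by
    funext i
    refine Fin.lastCases ?_ (fun i => ?_) i
    · simp [stdIndex]; ring
    refine Fin.lastCases ?_ (fun i => ?_) i <;> simp [stdIndex]
  rw [h, rowDet_snoc, Fin.cons_snoc_eq_snoc_cons, rowDet_snoc, ← mul_assoc, ← mul_pow]
  simp [pairDet]

lemma sum_rowDet_stdIndex_sub_one :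
    ∑ a, rowDet v (update (stdIndex m) a (stdIndex m a - 1)) =
      rowDet v (update (stdIndex m) 0 (-1)) := by
  rw [Finset.sum_eq_single 0]
  · simp [stdIndex]
  · rintro ⟨a, ha⟩ - h0
    have h : a ≠ 0 := by simpa [Fin.ext_iff] using h0
    refine rowDet_eq_zero v (a := ⟨a, ha⟩) (b := ⟨a - 1, by omega⟩)
      (by simp [Fin.ext_iff]; omega) ?_
    simp [update_apply, Fin.ext_iff, stdIndex]
    omega
  · simp

lemma sum_rowDet_stdIndex_add_one :
    ∑ a, rowDet v (update (stdIndex m) a (stdIndex m a + 1)) =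
      rowDet v (update (stdIndex m) (Fin.last _) (m + 2)) := by
  rw [Finset.sum_eq_single (Fin.last _)]
  · simp [stdIndex, add_assoc]
  · rintro ⟨a, ha⟩ - h0
    have h : a ≠ m + 1 := by simpa [Fin.ext_iff] using h0
    refine rowDet_eq_zero v (a := ⟨a, ha⟩) (b := ⟨a + 1, by omega⟩)
      (by simp [Fin.ext_iff]) ?_
    simp [Fin.ext_iff, stdIndex]
  · simp

lemma sum_rowDet_stdIndex_sub_two :
    ∑ a, rowDet v (update (stdIndex m) a (stdIndex m a - 2)) =
      rowDet v (update (stdIndex m) 0 (-2))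
        - rowDet v (update (update (stdIndex m) 0 (-1)) 1 0) := by
  have hswap : rowDet v (update (stdIndex m) 1 (-1)) =
      -rowDet v (update (update (stdIndex m) 0 (-1)) 1 0) := by
    have h := rowDet_comp_perm v (update (update (stdIndex m) 0 (-1)) 1 0) (Equiv.swap 0 1)
    rw [Equiv.Perm.sign_swap (by simp)] at h
    rw [← neg_one_mul]
    convert h using 2
    · funext i
      by_cases h0 : i = 0
      · subst h0; simp [stdIndex]
      by_cases h1 : i = 1
      · subst h1; simp
      · simp [Equiv.swap_apply_of_ne_of_ne h0 h1, h0, h1]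
    · simp
  rw [Finset.sum_eq_add 0 1 (by simp)]
  · simp [stdIndex, hswap, ← sub_eq_add_neg]
  · rintro ⟨a, ha⟩ - ⟨h0, h1⟩
    have h : a ≠ 0 := by simpa [Fin.ext_iff] using h0
    have h' : a ≠ 1 := by simpa [Fin.ext_iff] using h1
    refine rowDet_eq_zero v (a := ⟨a, ha⟩) (b := ⟨a - 2, by omega⟩)
      (by simp [Fin.ext_iff]; omega) ?_
    simp [update_apply, Fin.ext_iff, stdIndex]
    omega
  · simp
  · simp

lemma sum_rowDet_update_zero_sub_one :
    ∑ a, rowDet v (update (update (stdIndex m) 0 (-1)) a (update (stdIndex m) 0 (-1) a - 1)) =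
      rowDet v (update (stdIndex m) 0 (-2))
        + rowDet v (update (update (stdIndex m) 0 (-1)) 1 0) := by
  rw [Finset.sum_eq_add 0 1 (by simp)]
  · simp [stdIndex]
  · rintro ⟨a, ha⟩ - ⟨h0, h1⟩
    have h : a ≠ 0 := by simpa [Fin.ext_iff] using h0
    have h' : a ≠ 1 := by simpa [Fin.ext_iff] using h1
    refine rowDet_eq_zero v (a := ⟨a, ha⟩) (b := ⟨a - 1, by omega⟩)
      (by simp [Fin.ext_iff]; omega) ?_
    simp [update_apply, Fin.ext_iff, stdIndex]
    grind
  · simp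
  · simp

lemma sum_rowDet_update_last_sub_one :
    ∑ a, rowDet v (update (update (stdIndex m) (Fin.last _) (m + 2)) a
        (update (stdIndex m) (Fin.last _) (m + 2 : ℤ) a - 1)) =
      rowDet v (update (update (stdIndex m) (Fin.last _) (m + 2)) 0 (-1))
        + rowDet v (stdIndex m) := by
  rw [Finset.sum_eq_add 0 (Fin.last _) (by simp [Fin.ext_iff])]
  · refine congrArg₂ _ ?_ ?_
    · rw [update_of_ne (by simp [Fin.ext_iff])]
      simp [stdIndex]
    · rw [update_idem, update_self, show (m + 2 - 1 : ℤ) = m + 1 by ring, update_last_stdIndex]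
  · rintro ⟨a, ha⟩ - ⟨h0, h1⟩
    have h : a ≠ 0 := by simpa [Fin.ext_iff] using h0
    have h' : a ≠ m + 1 := by simpa [Fin.ext_iff] using h1
    refine rowDet_eq_zero v (a := ⟨a, ha⟩) (b := ⟨a - 1, by omega⟩)
      (by simp [Fin.ext_iff]; omega) ?_
    simp [update_apply, Fin.ext_iff, stdIndex]
    grind
  · simp
  · simp

lemma rowDet_update_zero_stdIndex_sub_one (x : ℤ) :
    rowDet v (fun a => update (stdIndex m) 0 x a - 1) = pairDet v (x - 1) 0 := by
  rw [pairDet]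
  congr 1
  funext i
  refine Fin.cases ?_ (fun i => ?_) i
  · simp
  refine Fin.cases ?_ (fun i => ?_) i <;> simp [stdIndex]

lemma rowDet_update_one_stdIndex_sub_one (x y : ℤ) :
    rowDet v (fun a => update (update (stdIndex m) 0 x) 1 y a - 1) =
      pairDet v (x - 1) (y - 1) := by
  rw [pairDet]
  congr 1
  funext i
  refine Fin.cases ?_ (fun i => ?_) i
  · simp
  refine Fin.cases ?_ (fun i => ?_) i <;> simp [stdIndex, Fin.ext_iff]

end consecutive

section partialDerivatives

variable {f g : ℂ → ℂ → ℂ → ℂ → ℂ}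

lemma dT_eq_of_hasDerivAt (h : ∀ n t y z, HasDerivAt (fun s => f n s y z) (g n t y z) t) :
    dT f = g := by
  funext n t y z; exact (h n t y z).deriv

lemma dY_eq_of_hasDerivAt (h : ∀ n t y z, HasDerivAt (fun s => f n t s z) (g n t y z) y) :
    dY f = g := by
  funext n t y z; exact (h n t y z).deriv

lemma dZ_eq_of_hasDerivAt (h : ∀ n t y z, HasDerivAt (fun s => f n t y s) (g n t y z) z) :
    dZ f = g := by
  funext n t y z; exact (h n t y z).deriv

end partialDerivatives

section lump

variable {N : ℕ} (p β : Fin N → ℂ)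

/-- The rows of the multi-lump determinant, written in terms of `p k = -λ k`. -/
noncomputable def lumpRow (n t y z : ℂ) (j : ℤ) (k : Fin N) : ℂ :=
  p k ^ j * (n - j * Complex.I - (p k)⁻¹ * t + (2 / p k ^ 2 + p k) * y + 2 / p k ^ 2 * z + β k)

/-- The multi-lump determinant with arbitrary row indices. -/
noncomputable def lumpDet (J : Fin N → ℤ) (n t y z : ℂ) : ℂ :=
  rowDet (lumpRow p β n t y z) J

variable {p}

lemma lumpRow_add_I (hp : ∀ k, p k ≠ 0) (n t y z : ℂ) (j : ℤ) (k : Fin N) :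
    lumpRow p β (n + Complex.I) t y z j k = p k * lumpRow p β n t y z (j - 1) k := by
  rw [lumpRow, lumpRow, zpow_sub_one₀ (hp k)]
  have := hp k
  push_cast
  field_simp
  ring

lemma lumpDet_add_I (hp : ∀ k, p k ≠ 0) (J : Fin N → ℤ) (n t y z : ℂ) :
    lumpDet p β J (n + Complex.I) t y z =
      (∏ k, p k) * lumpDet p β (fun a => J a - 1) n t y z := by
  simp_rw [lumpDet, rowDet, lumpRow_add_I β hp]
  exact det_mul_row p _

lemma lumpDet_sub_I (hp : ∀ k, p k ≠ 0) (J : Fin N → ℤ) (n t y z : ℂ) :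
    (∏ k, p k) * lumpDet p β J (n - Complex.I) t y z =
      lumpDet p β (fun a => J a + 1) n t y z := by
  have h := lumpDet_add_I β hp (fun a => J a + 1) (n - Complex.I) t y z
  simpa using h.symm

lemma hasDerivAt_lumpDet_t (hp : ∀ k, p k ≠ 0) (J : Fin N → ℤ) (n t y z : ℂ) :
    HasDerivAt (fun s => lumpDet p β J n s y z)
      (Complex.I * ∑ a, lumpDet p β (update J a (J a - 1)) n t y z
        - Complex.I * (∑ k, (p k)⁻¹) * lumpDet p β J n t y z) t := by
  have h := hasDerivAt_rowDet (v := fun s => lumpRow p β n s y z) (x := t)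
    (α := Complex.I) (q := -1) (α' := 0) (q' := 0) (d := fun k => -Complex.I * (p k)⁻¹)
    (fun j k => by
      have hk := hp k
      unfold lumpRow
      refine HasDerivAt.congr_deriv (((((((hasDerivAt_id' t).const_mul _).const_sub _).add_const
        _).add_const _).add_const _).const_mul _) ?_
      rw [← sub_eq_add_neg, zpow_sub_one₀ hk]
      push_cast
      linear_combination (-(p k ^ j * (p k)⁻¹)) * Complex.I_mul_I) J
  refine h.congr_deriv ?_
  rw [← Finset.mul_sum]
  simp only [lumpDet, ← sub_eq_add_neg]
  ring

lemma hasDerivAt_lumpDet_z (hp : ∀ k, p k ≠ 0) (J : Fin N → ℤ) (n t y z : ℂ) :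
    HasDerivAt (fun s => lumpDet p β J n t y s)
      (-Complex.I * ∑ a, lumpDet p β (update J a (J a - 2)) n t y z
        + Complex.I * (∑ k, (p k ^ 2)⁻¹) * lumpDet p β J n t y z) z := by
  have h := hasDerivAt_rowDet (v := fun s => lumpRow p β n t y s) (x := z)
    (α := -Complex.I) (q := -2) (α' := 0) (q' := 0) (d := fun k => Complex.I * (p k ^ 2)⁻¹)
    (fun j k => by
      have hk := hp k
      unfold lumpRow
      refine HasDerivAt.congr_deriv (((((hasDerivAt_id' z).const_mul _).const_add
        _).add_const _).const_mul _) ?_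
      rw [← sub_eq_add_neg, zpow_sub₀ hk, zpow_ofNat]
      push_cast
      linear_combination (2 * (p k ^ j * (p k ^ 2)⁻¹)) * Complex.I_mul_I) J
  refine h.congr_deriv ?_
  rw [← Finset.mul_sum]
  simp only [lumpDet, ← sub_eq_add_neg]
  ring

lemma hasDerivAt_lumpDet_y (hp : ∀ k, p k ≠ 0) (J : Fin N → ℤ) (n t y z : ℂ) :
    HasDerivAt (fun s => lumpDet p β J n t s z)
      (-Complex.I * ∑ a, lumpDet p β (update J a (J a - 2)) n t y z
        + Complex.I * ∑ a, lumpDet p β (update J a (J a + 1)) n t y z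
        + Complex.I * (∑ k, ((p k ^ 2)⁻¹ - p k)) * lumpDet p β J n t y z) y := by
  have h := hasDerivAt_rowDet (v := fun s => lumpRow p β n t s z) (x := y)
    (α := -Complex.I) (q := -2) (α' := Complex.I) (q' := 1)
    (d := fun k => Complex.I * ((p k ^ 2)⁻¹ - p k))
    (fun j k => by
      have hk := hp k
      unfold lumpRow
      refine HasDerivAt.congr_deriv ((((((hasDerivAt_id' y).const_mul _).const_add
        _).add_const _).add_const _).const_mul _) ?_
      rw [← sub_eq_add_neg, zpow_sub₀ hk, zpow_add_one₀ hk, zpow_ofNat]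
      push_cast
      linear_combination (2 * (p k ^ j * (p k ^ 2)⁻¹) + p k ^ j * p k) * Complex.I_mul_I) J
  refine h.congr_deriv ?_
  rw [← Finset.mul_sum]
  simp only [lumpDet, ← sub_eq_add_neg]

end lump

/-- The multi-lump determinant of size at least two solves the system. -/
lemma variantBS_lumpDet {m : ℕ} {p : Fin (m + 2) → ℂ} (hp : ∀ k, p k ≠ 0) (β : Fin (m + 2) → ℂ) :
    VariantBS (lumpDet p β (stdIndex m)) := by
  have hA := hasDerivAt_lumpDet_t β hp (update (stdIndex m) 0 (-1))
  have hD := hasDerivAt_lumpDet_t β hp (update (stdIndex m) (Fin.last _) (m + 2))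
  have hτ := hasDerivAt_lumpDet_t β hp (stdIndex m)
  have hB := hasDerivAt_lumpDet_t β hp (update (stdIndex m) 0 (-2))
  have hC := hasDerivAt_lumpDet_t β hp (update (update (stdIndex m) 0 (-1)) 1 0)
  have hτz := hasDerivAt_lumpDet_z β hp (stdIndex m)
  have hτy := hasDerivAt_lumpDet_y β hp (stdIndex m)
  have sum_τ (n t y z : ℂ) : ∑ a, lumpDet p β (update (stdIndex m) a (stdIndex m a - 1)) n t y z =
      lumpDet p β _ n t y z := sum_rowDet_stdIndex_sub_one _
  have sum_τ' (n t y z : ℂ) : ∑ a, lumpDet p β (update (stdIndex m) a (stdIndex m a + 1)) n t y z =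
      lumpDet p β _ n t y z := sum_rowDet_stdIndex_add_one _
  have sum_τ₂ (n t y z : ℂ) : ∑ a, lumpDet p β (update (stdIndex m) a (stdIndex m a - 2)) n t y z =
      lumpDet p β _ n t y z - lumpDet p β _ n t y z := sum_rowDet_stdIndex_sub_two _
  have sum_A (n t y z : ℂ) : ∑ a, lumpDet p β (update (update (stdIndex m) 0 (-1)) a
      (update (stdIndex m) 0 (-1) a - 1)) n t y z =
      lumpDet p β _ n t y z + lumpDet p β _ n t y z := sum_rowDet_update_zero_sub_one _
  have sum_D (n t y z : ℂ) : ∑ a, lumpDet p β (update (update (stdIndex m) (Fin.last _) (m + 2)) a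
      (update (stdIndex m) (Fin.last _) (m + 2 : ℤ) a - 1)) n t y z =
      lumpDet p β _ n t y z + lumpDet p β _ n t y z := sum_rowDet_update_last_sub_one _
  simp only [sum_τ, sum_τ', sum_τ₂, sum_A, sum_D] at hA hD hτ hτz hτy
  have eT := dT_eq_of_hasDerivAt hτ
  have eZ := dZ_eq_of_hasDerivAt hτz
  have eY := dY_eq_of_hasDerivAt hτy
  have eTT := dT_eq_of_hasDerivAt fun n t y z => ((hA n t y z).const_mul Complex.I).fun_sub
    ((hτ n t y z).const_mul (Complex.I * ∑ k, (p k)⁻¹))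
  have eTZ := dT_eq_of_hasDerivAt fun n t y z =>
    (((hB n t y z).fun_sub (hC n t y z)).const_mul (-Complex.I)).fun_add
      ((hτ n t y z).const_mul (Complex.I * ∑ k, (p k ^ 2)⁻¹))
  have eTY := dT_eq_of_hasDerivAt fun n t y z =>
    ((((hB n t y z).fun_sub (hC n t y z)).const_mul (-Complex.I)).fun_add
      ((hD n t y z).const_mul Complex.I)).fun_add
      ((hτ n t y z).const_mul (Complex.I * ∑ k, ((p k ^ 2)⁻¹ - p k)))
  intro n t y z
  constructor
  · rw [eT, eTT, eZ]
    simp only [lumpDet_add_I β hp]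
    simp only [lumpDet, rowDet_stdIndex, rowDet_update_zero_stdIndex, rowDet_stdIndex_sub_one,
      rowDet_update_zero_stdIndex_sub_one, rowDet_update_one_stdIndex_sub_one]
    norm_num only
    have hP := pairDet_plucker (lumpRow p β n t y z) (-2) (-1) (m + 1) 0
    have hs := pairDet_swap (lumpRow p β n t y z) (-2) (m + 1)
    generalize ((-1) ^ (m + 1) : ℂ) = ε
    rw [hs]
    linear_combination (-2 * Complex.I ^ 2 * (∏ k, p k) * ε) * hP
  · have hprod : lumpDet p β (stdIndex m) (n + Complex.I) t y z *
        lumpDet p β (stdIndex m) (n - Complex.I) t y z =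
        pairDet (lumpRow p β n t y z) (-1) 0 * pairDet (lumpRow p β n t y z) (m + 1) (m + 2) := by
      rw [lumpDet_add_I β hp, mul_right_comm, lumpDet_sub_I β hp, mul_comm, lumpDet, lumpDet,
        rowDet_stdIndex_sub_one, rowDet_stdIndex_add_one]
    rw [hprod, eT, eZ, eY, eTZ, eTY]
    simp only [lumpDet, rowDet_stdIndex, rowDet_update_zero_stdIndex,
      rowDet_update_last_stdIndex, rowDet_update_update_stdIndex]
    have hP := pairDet_plucker (lumpRow p β n t y z) (m + 2) (-1) (m + 1) 0
    have hs := pairDet_swap (lumpRow p β n t y z) (m + 1) (m + 2)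
    have hε : ((-1) ^ (m + 1) * (-1) ^ (m + 1) : ℂ) = 1 := by rw [← mul_pow]; simp
    generalize ((-1) ^ (m + 1) : ℂ) = ε at hε ⊢
    rw [hs] at hP
    generalize pairDet (lumpRow p β n t y z) = Q at hP ⊢
    linear_combination ε ^ 2 * hP - Q (-1) 0 * Q (m + 1) (m + 2) * hε
      - ε ^ 2 * (Q (m + 2) (-1) * Q (m + 1) 0 - Q (m + 1) (-1) * Q (m + 2) 0
        + Q (m + 1) 0 ^ 2) * Complex.I_sq

/-- A single lump solves the system. -/
lemma variantBS_affine {l : ℂ} (hl : l ≠ 0) (b : ℂ) :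
    VariantBS fun n t y z => n + l⁻¹ * t + (2 / l ^ 2 - l) * y + 2 / l ^ 2 * z + b := by
  have eT := dT_eq_of_hasDerivAt fun n t y z => (((((hasDerivAt_id' t).const_mul l⁻¹).const_add
    n).add_const ((2 / l ^ 2 - l) * y)).add_const (2 / l ^ 2 * z)).add_const b
  have eY := dY_eq_of_hasDerivAt fun n t y z => ((((hasDerivAt_id' y).const_mul
    (2 / l ^ 2 - l)).const_add (n + l⁻¹ * t)).add_const (2 / l ^ 2 * z)).add_const b
  have eZ := dZ_eq_of_hasDerivAt fun n t y z => (((hasDerivAt_id' z).const_mul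
    (2 / l ^ 2)).const_add (n + l⁻¹ * t + (2 / l ^ 2 - l) * y)).add_const b
  have hconst (c : ℂ) : (dT fun _ _ _ _ => c) = fun _ _ _ _ => 0 :=
    dT_eq_of_hasDerivAt fun _ t _ _ => hasDerivAt_const t c
  intro n t y z
  rw [eT, eY, eZ, hconst, hconst, hconst]
  constructor
  · linear_combination (2 / l ^ 2) * Complex.I_sq
  · linear_combination -Complex.I_sq - mul_inv_cancel₀ hl

/-- the `N × N` determinant with entries `(−λ_k)^{j−1} τ_k(n − (j−1)i)`
obtained from repeated nonlinear superposition solves the variant bilinear BS system. -/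
theorem multi_lump_determinant_solves_variantBS (N : ℕ) (hN : 1 ≤ N)
    (lam : Fin N → ℂ) (hlam : ∀ k, lam k ≠ 0) (β : Fin N → ℂ) :
    VariantBS (fun n t y z =>
      Matrix.det (Matrix.of (fun j k : Fin N =>
        (-(lam k)) ^ (j : ℕ) *
          ((n - (j : ℕ) * Complex.I) + (lam k)⁻¹ * t + (2 / (lam k) ^ 2 - lam k) * y
            + 2 / (lam k) ^ 2 * z + β k)))) := by
  obtain _ | _ | m := N
  · omega
  · simpa using variantBS_affine (hlam 0) (β 0)
  · convert variantBS_lumpDet (p := fun k => -lam k) (fun k => neg_ne_zero.2 (hlam k)) β using 5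
      with n t y z
    rw [lumpDet, rowDet]
    congr 1
    ext j k
    simp [lumpRow, stdIndex, inv_neg, sub_eq_add_neg]
end

section
/- Let α₁, α₂, β₁, β₂ ∈ ℝ with β₁ > 0, β₂ > 0 and (α₁, β₁) ≠ (α₂, β₂). Then for all real X₁, X₂, Θ: e^{2X₁}/(2β₁) + e^{2X₂}/(2β₂) + 2 e^{X₁+X₂} · ((β₁+β₂) cos Θ + (α₂−α₁) sin Θ) / ((β₁+β₂)² + (α₁−α₂)²) > 0. Consequently the breather tau function τ = e^{2ζ̃₁}/(2β₁) + e^{2ζ̃₂}/(2β₂) + 2(β₁+β₂) e^{ζ̃₁+ζ̃₂} cos(ζ̃₃)/((β₁+β₂)²+(α₁−α₂)²) + 2(α₂−α₁) e^{ζ̃₁+ζ̃₂} sin(ζ̃₃)/((β₁+β₂)²+(α₁−α₂)²) is strictly positive for all real arguments, and the breather solution u(n) of the variant Blaszak–Szum lattice is non-singular. -/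
/-- A binary quadratic form with positive leading coefficient and negative discriminant is positive
away from `y = 0`. -/
theorem binary_quadratic_pos {p q r x y : ℝ} (hp : 0 < p) (hdisc : q ^ 2 < p * r) (hy : y ≠ 0) :
    0 < p * x ^ 2 + 2 * q * (x * y) + r * y ^ 2 := by
  have hsq : 0 < y ^ 2 * (p * r - q ^ 2) := mul_pos (by positivity) (sub_pos.2 hdisc)
  refine pos_of_mul_pos_right (a := p) ?_ hp.le
  nlinarith [sq_nonneg (p * x + q * y)]

theorem sq_mul_cos_add_mul_sin_le (s d θ : ℝ) :
    (s * Real.cos θ + d * Real.sin θ) ^ 2 ≤ s ^ 2 + d ^ 2 := by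
  have h : s ^ 2 + d ^ 2 - (s * Real.cos θ + d * Real.sin θ) ^ 2
      = (s * Real.sin θ - d * Real.cos θ) ^ 2 := by
    linear_combination (-(s ^ 2 + d ^ 2)) * Real.sin_sq_add_cos_sq θ
  linarith [sq_nonneg (s * Real.sin θ - d * Real.cos θ)]

theorem four_mul_lt_add_sq_add_sub_sq {α1 α2 β1 β2 : ℝ} (hne : (α1, β1) ≠ (α2, β2)) :
    4 * (β1 * β2) < (β1 + β2) ^ 2 + (α1 - α2) ^ 2 := by
  have h : 0 < (β1 - β2) ^ 2 + (α1 - α2) ^ 2 := by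
    by_cases hα : α1 = α2
    · have hβ : β1 - β2 ≠ 0 := sub_ne_zero.2 fun hβ => hne (by rw [hα, hβ])
      positivity
    · have hα' : α1 - α2 ≠ 0 := sub_ne_zero.2 hα
      positivity
  linarith

/-- positivity of the breather tau function of the variant Blaszak–Szum
lattice: for `β₁, β₂ > 0` with `(α₁, β₁) ≠ (α₂, β₂)`, and for all real phases `X₁, X₂, Θ`,
`e^{2X₁}/(2β₁) + e^{2X₂}/(2β₂) + 2e^{X₁+X₂}((β₁+β₂)cos Θ + (α₂−α₁)sin Θ)
/((β₁+β₂)² + (α₁−α₂)²) > 0`; hence the breather solution is non-singular. -/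
theorem breather_tau_positive (α1 α2 β1 β2 : ℝ) (hβ1 : 0 < β1) (hβ2 : 0 < β2)
    (hne : (α1, β1) ≠ (α2, β2)) :
    ∀ X1 X2 Θ : ℝ,
      0 < Real.exp (2 * X1) / (2 * β1) + Real.exp (2 * X2) / (2 * β2)
          + 2 * Real.exp (X1 + X2) * ((β1 + β2) * Real.cos Θ + (α2 - α1) * Real.sin Θ)
            / ((β1 + β2) ^ 2 + (α1 - α2) ^ 2) := by
  intro X1 X2 Θ
  have hK := four_mul_lt_add_sq_add_sub_sq hne
  have hM := sq_mul_cos_add_mul_sin_le (β1 + β2) (α2 - α1) Θ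
  rw [← neg_sub α1 α2, neg_sq, neg_sub] at hM
  have hKpos : 0 < (β1 + β2) ^ 2 + (α1 - α2) ^ 2 := by positivity
  rw [two_mul X1, two_mul X2, Real.exp_add, Real.exp_add, Real.exp_add]
  generalize (β1 + β2) ^ 2 + (α1 - α2) ^ 2 = K at *
  generalize (β1 + β2) * Real.cos Θ + (α2 - α1) * Real.sin Θ = M at *
  have hdisc : (M / K) ^ 2 < 1 / (2 * β1) * (1 / (2 * β2)) := by
    calc (M / K) ^ 2 ≤ K / K ^ 2 := by rw [div_pow]; gcongr
      _ = 1 / K := by field_simp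
      _ < 1 / (4 * (β1 * β2)) := one_div_lt_one_div_of_lt (by positivity) hK
      _ = 1 / (2 * β1) * (1 / (2 * β2)) := by field_simp; norm_num
  have h := binary_quadratic_pos (x := Real.exp X1) (by positivity) hdisc (Real.exp_ne_zero X2)
  convert h using 1
  ring
end
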